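/- (Local John–Nirenberg inequality for rbmo(μ).) There exist constants C₄ > 0 and C₅ > 0, depending only on ρ, such that for every f ∈ rbmo(μ) with ‖f‖_{rbmo(μ)} > 0 and every λ > 0: (i) for every cube Q with ℓ(Q) ≤ 1, μ({x ∈ Q : |f(x) − f_{Q̃}| > λ}) ≤ C₄ μ(ρQ) exp(−C₅ λ / ‖f‖_{rbmo(μ)}); and (ii) for every cube Q with ℓ(Q) > 1, μ({x ∈ Q : |f(x)| > λ}) ≤ C₄ μ(ρQ) exp(−C₅ λ / ‖f‖_{rbmo(μ)}). -/

import Mathlib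

open MeasureTheory Metric Set Filter
open scoped ENNReal NNReal BigOperators Topology

noncomputable section

/-- Euclidean space `ℝ^d`. -/
abbrev Euc (d : ℕ) := EuclideanSpace ℝ (Fin d)

/-- A (closed, axis-parallel) cube in `ℝ^d`, given by its center and side length. -/
structure Cube (d : ℕ) where
  center : Euc d
  side : ℝ

namespace Cube

/-- The underlying set of a cube. -/
def set {d : ℕ} (Q : Cube d) : Set (Euc d) :=
  {y : Euc d | ∀ i, |y i - Q.center i| ≤ Q.side / 2}

/-- The concentric dilate `αQ` of a cube. -/
def dilate {d : ℕ} (Q : Cube d) (α : ℝ) : Cube d := ⟨Q.center, α * Q.side⟩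

end Cube

/-- `Q` is a genuine cube for `μ`: positive side length, centered at a point of `supp μ`. -/
def IsCube {d : ℕ} (μ : Measure (Euc d)) (Q : Cube d) : Prop :=
  0 < Q.side ∧ ∀ r : ℝ, 0 < r → 0 < μ (Metric.ball Q.center r)

/-- The mean value `f_Q = μ(Q)⁻¹ ∫_Q f dμ`. -/
def cubeAvg {d : ℕ} (μ : Measure (Euc d)) (Q : Cube d) (f : Euc d → ℝ) : ℝ :=
  (μ Q.set).toReal⁻¹ * ∫ x in Q.set, f x ∂μ

/-- `N_{Q,R}`: the smallest positive integer `k` with `2^k ℓ(Q) ≥ ℓ(R)`. -/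
def NQR {d : ℕ} (Q R : Cube d) : ℕ :=
  sInf {k : ℕ | 0 < k ∧ R.side ≤ 2 ^ k * Q.side}

/-- The Tolsa coefficient `S_{Q,R} = 1 + ∑_{k=1}^{N_{Q,R}} μ(2^k Q)/ℓ(2^k Q)^n`. -/
def SQR {d : ℕ} (μ : Measure (Euc d)) (n : ℕ) (Q R : Cube d) : ℝ :=
  1 + ∑ k ∈ Finset.Icc 1 (NQR Q R),
      (μ (Q.dilate (2 ^ k)).set).toReal / (2 ^ k * Q.side) ^ n

/-- `Q` is `(α,β)`-doubling: `μ(αQ) ≤ β μ(Q)`. -/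
def IsDoubling {d : ℕ} (μ : Measure (Euc d)) (α β : ℝ) (Q : Cube d) : Prop :=
  μ (Q.dilate α).set ≤ ENNReal.ofReal β * μ Q.set

/-- `Q̃ = 2^N Q`, `N` the smallest non-negative integer making `2^N Q` `(ρ,β)`-doubling. -/
def tilde {d : ℕ} (μ : Measure (Euc d)) (ρ β : ℝ) (Q : Cube d) : Cube d :=
  Q.dilate (2 ^ sInf {N : ℕ | IsDoubling μ ρ β (Q.dilate (2 ^ N))})

/-- `C` is an `RBMO(μ)` bound for `f` (with parameters `η, ρ, β`). -/
def RBMOBound {d : ℕ} (μ : Measure (Euc d)) (n : ℕ) (η ρ β : ℝ)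
    (f : Euc d → ℝ) (C : ℝ) : Prop :=
  (∀ Q : Cube d, IsCube μ Q →
      ∫ x in Q.set, |f x - cubeAvg μ (tilde μ ρ β Q) f| ∂μ
        ≤ C * (μ (Q.dilate η).set).toReal) ∧
  (∀ Q R : Cube d, IsCube μ Q → IsCube μ R → Q.set ⊆ R.set →
      IsDoubling μ ρ β Q → IsDoubling μ ρ β R →
      |cubeAvg μ Q f - cubeAvg μ R f| ≤ C * SQR μ n Q R)

/-- `f ∈ RBMO(μ)`. -/
def MemRBMO {d : ℕ} (μ : Measure (Euc d)) (n : ℕ) (η ρ β : ℝ) (f : Euc d → ℝ) : Prop :=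
  LocallyIntegrable f μ ∧ ∃ C : ℝ, 0 ≤ C ∧ RBMOBound μ n η ρ β f C

/-- The `RBMO(μ)` norm of `f`. -/
def rbmoNorm {d : ℕ} (μ : Measure (Euc d)) (n : ℕ) (η ρ β : ℝ) (f : Euc d → ℝ) : ℝ :=
  sInf {C : ℝ | 0 ≤ C ∧ RBMOBound μ n η ρ β f C}

/-- `C` is an `rbmo(μ)` (local `RBMO`) bound for `f`. -/
def RbmoLocBound {d : ℕ} (μ : Measure (Euc d)) (n : ℕ) (η ρ β : ℝ)
    (f : Euc d → ℝ) (C : ℝ) : Prop :=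
  (∀ Q : Cube d, IsCube μ Q → Q.side ≤ 1 →
      ∫ x in Q.set, |f x - cubeAvg μ (tilde μ ρ β Q) f| ∂μ
        ≤ C * (μ (Q.dilate η).set).toReal) ∧
  (∀ Q R : Cube d, IsCube μ Q → IsCube μ R → Q.side ≤ 1 → Q.set ⊆ R.set →
      IsDoubling μ ρ β Q → IsDoubling μ ρ β R →
      |cubeAvg μ Q f - cubeAvg μ R f| ≤ C * SQR μ n Q R) ∧
  (∀ Q : Cube d, IsCube μ Q → 1 < Q.side →
      ∫ x in Q.set, |f x| ∂μ ≤ C * (μ (Q.dilate η).set).toReal)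

/-- `f ∈ rbmo(μ)`. -/
def MemRbmoLoc {d : ℕ} (μ : Measure (Euc d)) (n : ℕ) (η ρ β : ℝ) (f : Euc d → ℝ) : Prop :=
  LocallyIntegrable f μ ∧ ∃ C : ℝ, 0 ≤ C ∧ RbmoLocBound μ n η ρ β f C

/-- The `rbmo(μ)` norm of `f`. -/
def rbmoLocNorm {d : ℕ} (μ : Measure (Euc d)) (n : ℕ) (η ρ β : ℝ) (f : Euc d → ℝ) : ℝ :=
  sInf {C : ℝ | 0 ≤ C ∧ RbmoLocBound μ n η ρ β f C}

/-- The data of an `∞`-block: `b = ∑ λ_j a_j`, supported in `R`, with `a_j` supported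
in `Q_j ⊂ R` and `‖a_j‖_{L^∞(μ)} ≤ (μ(2Q_j) S_{Q_j,R})⁻¹`, `∑_j |λ_j| < ∞`. -/
structure PreBlock {d : ℕ} (μ : Measure (Euc d)) (n : ℕ) : Type where
  R : Cube d
  Qs : ℕ → Cube d
  lam : ℕ → ℝ
  a : ℕ → Euc d → ℝ
  isCubeR : IsCube μ R
  isCubeQs : ∀ j, IsCube μ (Qs j)
  subsetQR : ∀ j, (Qs j).set ⊆ R.set
  measA : ∀ j, Measurable (a j)
  suppA : ∀ j, Function.support (a j) ⊆ (Qs j).set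
  boundA : ∀ j x, |a j x| ≤ ((μ ((Qs j).dilate 2).set).toReal * SQR μ n (Qs j) R)⁻¹
  summable : Summable fun j => |lam j|

/-- The function determined by a block. -/
def PreBlock.fn {d : ℕ} {μ : Measure (Euc d)} {n : ℕ} (b : PreBlock μ n) : Euc d → ℝ :=
  fun x => ∑' j, b.lam j * b.a j x

/-- `|b| = ∑_j |λ_j|`. -/
def PreBlock.size {d : ℕ} {μ : Measure (Euc d)} {n : ℕ} (b : PreBlock μ n) : ℝ :=
  ∑' j, |b.lam j|

/-- An `∞`-atomic block: an `∞`-block with vanishing integral. -/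
structure AtomicBlock {d : ℕ} (μ : Measure (Euc d)) (n : ℕ) extends PreBlock μ n where
  cancel : ∫ x, (∑' j, lam j * a j x) ∂μ = 0

/-- The function determined by an atomic block. -/
def AtomicBlock.fn {d : ℕ} {μ : Measure (Euc d)} {n : ℕ} (b : AtomicBlock μ n) : Euc d → ℝ :=
  b.toPreBlock.fn

/-- `|b|_{H¹} = ∑_j |λ_j|`. -/
def AtomicBlock.size {d : ℕ} {μ : Measure (Euc d)} {n : ℕ} (b : AtomicBlock μ n) : ℝ :=
  b.toPreBlock.size

/-- The class of test functions `F(x)` of Tolsa's grand maximal function. -/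
def TestFun {d : ℕ} (μ : Measure (Euc d)) (n : ℕ) (x : Euc d) (φ : Euc d → ℝ) : Prop :=
  Integrable φ μ ∧ ContDiff ℝ 1 φ ∧ (∫ y, |φ y| ∂μ) ≤ 1 ∧
  (∀ y, 0 ≤ φ y) ∧ (∀ y, y ≠ x → φ y ≤ (‖y - x‖ ^ n)⁻¹) ∧
  (∀ y, y ≠ x → ‖fderiv ℝ φ y‖ ≤ (‖y - x‖ ^ (n + 1))⁻¹)

/-- The grand maximal function `M f(x) = sup_{φ ∈ F(x)} |∫ f φ dμ|`. -/
def grandM {d : ℕ} (μ : Measure (Euc d)) (n : ℕ) (f : Euc d → ℝ) (x : Euc d) : ℝ :=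
  sSup {r : ℝ | ∃ φ : Euc d → ℝ, TestFun μ n x φ ∧ r = |∫ y, f y * φ y ∂μ|}

/-- The local class `F_loc(x)`: test functions supported in the cube `Q(x,1)`. -/
def TestFunLoc {d : ℕ} (μ : Measure (Euc d)) (n : ℕ) (x : Euc d) (φ : Euc d → ℝ) : Prop :=
  TestFun μ n x φ ∧ Function.support φ ⊆ (Cube.mk x 1).set

/-- The local grand maximal function `M^{(1)} f(x) = sup_{φ ∈ F_loc(x)} |∫ f φ dμ|`. -/
def grandMLoc {d : ℕ} (μ : Measure (Euc d)) (n : ℕ) (f : Euc d → ℝ) (x : Euc d) : ℝ :=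
  sSup {r : ℝ | ∃ φ : Euc d → ℝ, TestFunLoc μ n x φ ∧ r = |∫ y, f y * φ y ∂μ|}

/-- The Orlicz quasi-norm of `u` on the set `E`, for the Orlicz function `P`
(with value `∞` when no admissible constant exists). -/
def orliczNormOn {α : Type*} [MeasurableSpace α] (P : ℝ → ℝ) (lam : Measure α)
    (E : Set α) (u : α → ℝ) : ℝ≥0∞ :=
  sInf {k : ℝ≥0∞ | 0 < k ∧ k ≠ ∞ ∧
    ∫⁻ x in E, ENNReal.ofReal (P (|u x| / k.toReal)) ∂lam ≤ 1}

/-- The Orlicz quasi-norm of `u`. -/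
def orliczNorm {α : Type*} [MeasurableSpace α] (P : ℝ → ℝ) (lam : Measure α)
    (u : α → ℝ) : ℝ≥0∞ :=
  orliczNormOn P lam Set.univ u

/-- `℘(t) = t / log(e+t)`. -/
def wp (t : ℝ) : ℝ := t / Real.log (Real.exp 1 + t)

/-- `℘̃(t) = t · log(e+t)`. -/
def wpDual (t : ℝ) : ℝ := t * Real.log (Real.exp 1 + t)

/-- `Ξ(t) = e^t − 1`. -/
def XiFun (t : ℝ) : ℝ := Real.exp t - 1

/-- `dν(x) = dμ(x)/log(e+|x|)`. -/
def nuMeas {d : ℕ} (μ : Measure (Euc d)) : Measure (Euc d) :=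
  μ.withDensity fun x => ENNReal.ofReal (Real.log (Real.exp 1 + ‖x‖))⁻¹

/-- `dσ(x) = dμ(x)/(1+|x|)^{2n+κ}`. -/
def sigmaMeas {d : ℕ} (μ : Measure (Euc d)) (n : ℕ) (κ : ℝ) : Measure (Euc d) :=
  μ.withDensity fun x => ENNReal.ofReal (((1 + ‖x‖) ^ (2 * (n : ℝ) + κ))⁻¹)

/-- The unit cube `m + [0,1)^d` of the lattice `ℤ^d`. -/
def latCube (d : ℕ) (m : Fin d → ℤ) : Set (Euc d) :=
  {x : Euc d | ∀ i, (m i : ℝ) ≤ x i ∧ x i < (m i : ℝ) + 1}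

set_option linter.unusedSectionVars false

section BallJohnNirenberg

variable {E : Type*} [NormedAddCommGroup E] [NormedSpace ℝ E] [FiniteDimensional ℝ E]
  [MeasurableSpace E] [BorelSpace E]

/-- The (real-valued) mass of the closed ball `B(x, r)`. -/
def ballMass (μ : Measure E) (x : E) (r : ℝ) : ℝ := μ.real (closedBall x r)

/-- The mean value of `f` over the closed ball `B(x, r)`. -/
def ballAvg (μ : Measure E) (f : E → ℝ) (x : E) (r : ℝ) : ℝ :=
  (ballMass μ x r)⁻¹ * ∫ y in closedBall x r, f y ∂μ

/-- The ball `B(x, r)` is `(ρ, β)`-doubling. -/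
def BallDoubling (μ : Measure E) (ρ β : ℝ) (x : E) (r : ℝ) : Prop :=
  ballMass μ x (ρ * r) ≤ β * ballMass μ x r

/-- Polynomial growth of `μ`, together with a doubling constant `β = ρ ^ (n + 2γ)`. -/
structure BallGrowth (μ : Measure E) (n : ℕ) (ρ β γ C₀ : ℝ) : Prop where
  one_lt_ρ : 1 < ρ
  γ_pos : 0 < γ
  β_eq : β = ρ ^ ((n : ℝ) + 2 * γ)
  C₀_pos : 0 < C₀
  mass_le : ∀ x ∈ μ.support, ∀ r, 0 < r → ballMass μ x r ≤ C₀ * r ^ n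

/-- The defining conditions of the unit ball of `rbmo(μ)`, formulated with balls. -/
structure BallOsc (μ : Measure E) (n : ℕ) (η ρ β r₀ : ℝ) (f : E → ℝ) : Prop where
  locInt : LocallyIntegrable f μ
  osc_le : ∀ x ∈ μ.support, ∀ r, 0 < r → r ≤ r₀ → ∀ N : ℕ, BallDoubling μ ρ β x (2 ^ N * r) →
    (∀ k < N, ¬ BallDoubling μ ρ β x (2 ^ k * r)) →
    ∫ y in closedBall x r, |f y - ballAvg μ f x (2 ^ N * r)| ∂μ ≤ ballMass μ x (η * r)
  avg_sub_le : ∀ x ∈ μ.support, ∀ y ∈ μ.support, ∀ r s, 0 < r → r ≤ r₀ → r ≤ s →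
    closedBall x r ⊆ closedBall y s → BallDoubling μ ρ β x r → BallDoubling μ ρ β y s →
    ∀ N : ℕ, 0 < N → s ≤ 2 ^ N * r →
    |ballAvg μ f x r - ballAvg μ f y s| ≤
      1 + ∑ k ∈ Finset.Icc 1 N, ballMass μ x (2 ^ k * r) / (2 ^ k * r) ^ n
  large_le : ∀ x ∈ μ.support, ∀ r, r₀ < r →
    ∫ y in closedBall x r, |f y| ∂μ ≤ ballMass μ x (η * r)

/-- The radius of the first doubling ball among `B(x, ρ ^ j r)`, `j ≥ 0`. -/
def doublingRadius (μ : Measure E) (ρ β : ℝ) (x : E) (r : ℝ) : ℝ :=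
  ρ ^ sInf {j : ℕ | BallDoubling μ ρ β x (ρ ^ j * r)} * r

/-- The mean value over the first doubling ball among `B(x, ρ ^ j r)`, `j ≥ 0`. -/
def doublingAvg (μ : Measure E) (ρ β : ℝ) (f : E → ℝ) (x : E) (r : ℝ) : ℝ :=
  ballAvg μ f x (doublingRadius μ ρ β x r)

/-- The density of `μ` on the balls `B(x, t)`, `r ≤ t ≤ R`, decays like `(t / R) ^ γ`. -/
def DensityDecay (μ : Measure E) (n : ℕ) (γ : ℝ) (x : E) (r R C : ℝ) : Prop :=
  ∀ t, r ≤ t → t ≤ R → ballMass μ x t ≤ C * t ^ n * (t / R) ^ γ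

section Mass

variable {μ : Measure E}

lemma ballMass_nonneg (x : E) (r : ℝ) : 0 ≤ ballMass μ x r := measureReal_nonneg

variable [IsLocallyFiniteMeasure μ]

lemma measure_closedBall_ne_top (x : E) (r : ℝ) : μ (closedBall x r) ≠ ∞ := by
  have : ProperSpace E := FiniteDimensional.proper_real E
  exact (isCompact_closedBall x r).measure_lt_top.ne

lemma ballMass_le_of_subset {x y : E} {r s : ℝ} (h : closedBall x r ⊆ closedBall y s) :
    ballMass μ x r ≤ ballMass μ y s :=
  measureReal_mono h (measure_closedBall_ne_top y s)

lemma ballMass_mono (x : E) {r s : ℝ} (h : r ≤ s) : ballMass μ x r ≤ ballMass μ x s :=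
  ballMass_le_of_subset (closedBall_subset_closedBall h)

lemma ofReal_ballMass (x : E) (r : ℝ) :
    ENNReal.ofReal (ballMass μ x r) = μ (closedBall x r) :=
  ENNReal.ofReal_toReal (measure_closedBall_ne_top x r)

lemma ballMass_pos {x : E} (hx : x ∈ μ.support) {r : ℝ} (hr : 0 < r) : 0 < ballMass μ x r := by
  rw [ballMass, measureReal_def]
  refine ENNReal.toReal_pos ?_ (measure_closedBall_ne_top x r)
  exact ((Measure.mem_support_iff_forall _).1 hx _ (closedBall_mem_nhds x hr)).ne'

lemma abs_integral_ball_le_of_abs_le (f : E → ℝ) (x : E) (r : ℝ) {c : ℝ}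
    (h : ∫ y in closedBall x r, |f y| ∂μ ≤ c * ballMass μ x r) (hm : 0 < ballMass μ x r) :
    |ballAvg μ f x r| ≤ c := by
  rw [ballAvg, abs_mul, abs_inv, abs_of_pos hm, inv_mul_le_iff₀ hm, mul_comm]
  exact (abs_integral_le_integral_abs).trans h

end Mass

namespace BallGrowth

variable {μ : Measure E} {n : ℕ} {ρ β γ C₀ : ℝ}

lemma ρ_pos (h : BallGrowth μ n ρ β γ C₀) : 0 < ρ := zero_lt_one.trans h.one_lt_ρ

lemma one_lt_β (h : BallGrowth μ n ρ β γ C₀) : 1 < β := by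
  rw [h.β_eq]
  exact Real.one_lt_rpow h.one_lt_ρ (by have := h.γ_pos; positivity)

lemma pow_lt_β (h : BallGrowth μ n ρ β γ C₀) : ρ ^ n < β := by
  rw [h.β_eq, ← Real.rpow_natCast]
  exact Real.rpow_lt_rpow_of_exponent_lt h.one_lt_ρ (by have := h.γ_pos; linarith)

lemma β_pow (h : BallGrowth μ n ρ β γ C₀) (j : ℕ) :
    β ^ j = (ρ ^ j) ^ ((n : ℝ) + 2 * γ) := by
  rw [h.β_eq, ← Real.rpow_natCast, ← Real.rpow_mul h.ρ_pos.le, mul_comm, Real.rpow_mul h.ρ_pos.le,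
    Real.rpow_natCast]

lemma pow_mul_mass_le (h : BallGrowth μ n ρ β γ C₀) {x : E} {r : ℝ} {i j : ℕ} (hij : i ≤ j)
    (hd : ∀ k < j, β * ballMass μ x (ρ ^ k * r) ≤ ballMass μ x (ρ ^ (k + 1) * r)) :
    β ^ (j - i) * ballMass μ x (ρ ^ i * r) ≤ ballMass μ x (ρ ^ j * r) := by
  induction j, hij using Nat.le_induction with
  | base => simp
  | succ j hij ih =>
    have hβ := h.one_lt_β
    rw [Nat.sub_add_comm hij, pow_succ', mul_assoc]
    exact (mul_le_mul_of_nonneg_left (ih fun k hk => hd k (by omega)) (by linarith)).trans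
      (hd j (by omega))

lemma not_doubling {x : E} {r : ℝ} {k : ℕ} (h : ¬ BallDoubling μ ρ β x (ρ ^ k * r)) :
    β * ballMass μ x (ρ ^ k * r) ≤ ballMass μ x (ρ ^ (k + 1) * r) := by
  rw [BallDoubling, not_le] at h
  rw [pow_succ', mul_assoc]
  exact h.le

variable [IsLocallyFiniteMeasure μ]

lemma exists_doubling (h : BallGrowth μ n ρ β γ C₀) {x : E} (hx : x ∈ μ.support) {r : ℝ}
    (hr : 0 < r) : ∃ j : ℕ, BallDoubling μ ρ β x (ρ ^ j * r) := by
  by_contra! hc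
  have hρ := h.ρ_pos
  have h1 : ∀ j : ℕ, (β / ρ ^ n) ^ j ≤ C₀ * r ^ n / ballMass μ x r := by
    intro j
    have h2 := h.pow_mul_mass_le (x := x) (r := r) (Nat.zero_le j) fun k _ => not_doubling (hc k)
    have h3 := h.mass_le x hx (ρ ^ j * r) (by positivity)
    have hm := ballMass_pos hx hr
    rw [div_pow, div_le_div_iff₀ (by positivity) hm]
    simp only [Nat.sub_zero, pow_zero, one_mul] at h2
    calc β ^ j * ballMass μ x r ≤ C₀ * (ρ ^ j * r) ^ n := h2.trans h3
      _ = C₀ * r ^ n * (ρ ^ n) ^ j := by rw [mul_pow, ← pow_mul, ← pow_mul, mul_comm j n]; ring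
  have h4 : Tendsto (fun j : ℕ => (β / ρ ^ n) ^ j) atTop atTop :=
    tendsto_pow_atTop_atTop_of_one_lt ((one_lt_div (by positivity)).2 h.pow_lt_β)
  obtain ⟨j, hj⟩ := (h4.eventually_gt_atTop (C₀ * r ^ n / ballMass μ x r)).exists
  exact absurd (h1 j) (not_le.2 hj)

lemma exists_doublingRadius (h : BallGrowth μ n ρ β γ C₀) {x : E} (hx : x ∈ μ.support) {r : ℝ}
    (hr : 0 < r) : ∃ j : ℕ, doublingRadius μ ρ β x r = ρ ^ j * r ∧
      BallDoubling μ ρ β x (ρ ^ j * r) ∧ ∀ k < j, ¬ BallDoubling μ ρ β x (ρ ^ k * r) :=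
  ⟨_, rfl, Nat.sInf_mem (h.exists_doubling hx hr), fun _ hk hd => Nat.notMem_of_lt_sInf hk hd⟩

lemma doubling_doublingRadius (h : BallGrowth μ n ρ β γ C₀) {x : E} (hx : x ∈ μ.support) {r : ℝ}
    (hr : 0 < r) : BallDoubling μ ρ β x (doublingRadius μ ρ β x r) := by
  obtain ⟨j, hj, hd, -⟩ := h.exists_doublingRadius hx hr
  rwa [hj]

lemma le_doublingRadius (h : BallGrowth μ n ρ β γ C₀) (x : E) {r : ℝ} (hr : 0 < r) :
    r ≤ doublingRadius μ ρ β x r :=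
  le_mul_of_one_le_left hr.le (one_le_pow₀ h.one_lt_ρ.le)

lemma doublingRadius_eq_self {x : E} {r : ℝ} (hd : BallDoubling μ ρ β x r) :
    doublingRadius μ ρ β x r = r := by
  have : sInf {j : ℕ | BallDoubling μ ρ β x (ρ ^ j * r)} = 0 :=
    Nat.sInf_eq_zero.2 (Or.inl (by simpa using hd))
  simp [doublingRadius, this]

lemma decay_of_geometric (h : BallGrowth μ n ρ β γ C₀) {x : E} (hx : x ∈ μ.support) {r : ℝ}
    (hr : 0 < r) {j : ℕ}
    (hd : ∀ k < j, β * ballMass μ x (ρ ^ k * r) ≤ ballMass μ x (ρ ^ (k + 1) * r)) :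
    DensityDecay μ n γ x r (ρ ^ j * r) (β * C₀) := by
  have hρ := h.ρ_pos
  have hβ := h.one_lt_β
  have hC := h.C₀_pos
  have hγ := h.γ_pos
  intro t hrt htR
  have ht : 0 < t := hr.trans_le hrt
  set R := ρ ^ j * r with hR
  have hRpos : 0 < R := by positivity
  rcases htR.eq_or_lt with rfl | htR'
  · rw [div_self hRpos.ne', Real.one_rpow, mul_one]
    refine (h.mass_le x hx _ hRpos).trans ?_
    have : 0 ≤ C₀ * R ^ n := by positivity
    nlinarith
  obtain ⟨i, hi1, hi2⟩ := exists_nat_pow_near ((one_le_div hr).2 hrt) h.one_lt_ρ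
  rw [le_div_iff₀ hr] at hi1
  rw [div_lt_iff₀ hr] at hi2
  have hij : i < j := by
    have := (mul_lt_mul_iff_left₀ hr).1 (hi1.trans_lt htR')
    exact (pow_lt_pow_iff_right₀ h.one_lt_ρ).1 this
  have h1 := h.pow_mul_mass_le hij hd
  have h2 : β ^ (j - i) * ballMass μ x t ≤ β * (C₀ * R ^ n) := by
    have : j - i = (j - (i + 1)) + 1 := by omega
    rw [this, pow_succ', mul_assoc]
    refine mul_le_mul_of_nonneg_left ?_ (by linarith)
    refine (mul_le_mul_of_nonneg_left (ballMass_mono x hi2.le) (by positivity)).trans (h1.trans ?_)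
    exact h.mass_le x hx _ hRpos
  have h3 : 1 ≤ β ^ (j - i) * (t / R) ^ ((n : ℝ) + 2 * γ) := by
    rw [h.β_pow, ← Real.mul_rpow (by positivity) (by positivity)]
    refine Real.one_le_rpow ?_ (by positivity)
    rw [← mul_div_assoc, one_le_div hRpos, hR]
    calc ρ ^ j * r = ρ ^ (j - i) * (ρ ^ i * r) := by
          rw [← mul_assoc, ← pow_add, Nat.sub_add_cancel hij.le]
      _ ≤ _ := by gcongr
  have h4 : (t / R) ^ ((n : ℝ) + 2 * γ) ≤ t ^ n / R ^ n * (t / R) ^ γ := by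
    rw [Real.rpow_add (by positivity), Real.rpow_natCast, div_pow]
    refine mul_le_mul_of_nonneg_left ?_ (by positivity)
    exact Real.rpow_le_rpow_of_exponent_ge (by positivity) ((div_le_one hRpos).2 htR) (by linarith)
  have hm := ballMass_nonneg (μ := μ) x t
  calc ballMass μ x t ≤ ballMass μ x t * (β ^ (j - i) * (t / R) ^ ((n : ℝ) + 2 * γ)) :=
        le_mul_of_one_le_right hm h3
    _ = (β ^ (j - i) * ballMass μ x t) * (t / R) ^ ((n : ℝ) + 2 * γ) := by ring
    _ ≤ (β * (C₀ * R ^ n)) * (t ^ n / R ^ n * (t / R) ^ γ) := by gcongr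
    _ = β * C₀ * t ^ n * (t / R) ^ γ := by field_simp

lemma decay_doublingRadius (h : BallGrowth μ n ρ β γ C₀) {x : E} (hx : x ∈ μ.support) {r : ℝ}
    (hr : 0 < r) : DensityDecay μ n γ x r (doublingRadius μ ρ β x r) (β * C₀) := by
  obtain ⟨j, hj, -, hk⟩ := h.exists_doublingRadius hx hr
  rw [hj]
  exact h.decay_of_geometric hx hr fun k hkj => not_doubling (hk k hkj)

/-- On a bounded range of scales the density decay is automatic. -/
lemma decay_of_le_mul (h : BallGrowth μ n ρ β γ C₀) {x : E} (hx : x ∈ μ.support) {r R L : ℝ}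
    (hr : 0 < r) (hL : 0 < L) (hR : R ≤ L * r) : DensityDecay μ n γ x r R (C₀ * L ^ γ) := by
  intro t hrt htR
  have ht : 0 < t := hr.trans_le hrt
  have hR0 : 0 < R := ht.trans_le htR
  have hC := h.C₀_pos
  refine (h.mass_le x hx t ht).trans ?_
  have : 1 ≤ L ^ γ * (t / R) ^ γ := by
    rw [← Real.mul_rpow hL.le (by positivity)]
    refine Real.one_le_rpow ?_ h.γ_pos.le
    rw [← mul_div_assoc, one_le_div hR0]
    exact hR.trans (by gcongr)
  calc C₀ * t ^ n ≤ C₀ * t ^ n * (L ^ γ * (t / R) ^ γ) :=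
        le_mul_of_one_le_right (by positivity) this
    _ = _ := by ring

/-- Density decay passes to balls with nearby centers. -/
lemma decay_transfer (h : BallGrowth μ n ρ β γ C₀) {x y : E} (hx : x ∈ μ.support)
    {s R L C : ℝ} (hs : 0 < s) (hL : 0 ≤ L) (hC : 0 ≤ C) (hxy : dist x y ≤ L * s)
    (hd : DensityDecay μ n γ y s R C) :
    DensityDecay μ n γ x s R ((C * (1 + L) ^ n + C₀) * (1 + L) ^ γ) := by
  intro t hst htR
  have ht : 0 < t := hs.trans_le hst
  have hR0 : 0 < R := ht.trans_le htR
  have hC0 := h.C₀_pos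
  have hL1 : 0 < 1 + L := by linarith
  have hLL : (0 : ℝ) < (1 + L) ^ γ := Real.rpow_pos_of_pos hL1 γ
  have htR' : (0 : ℝ) < (t / R) ^ γ := Real.rpow_pos_of_pos (by positivity) γ
  by_cases hu : (1 + L) * t ≤ R
  · have h1 : ballMass μ x t ≤ ballMass μ y ((1 + L) * t) := by
      refine ballMass_le_of_subset (closedBall_subset_closedBall' ?_)
      nlinarith
    have h2 := hd ((1 + L) * t) (by nlinarith) hu
    rw [mul_pow, mul_div_assoc, Real.mul_rpow hL1.le (by positivity)] at h2
    refine h1.trans (h2.trans ?_)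
    have : 0 ≤ C₀ * (t ^ n * ((1 + L) ^ γ * (t / R) ^ γ)) := by positivity
    nlinarith
  · push Not at hu
    have h1 := h.decay_of_le_mul hx ht hL1 hu.le t le_rfl htR
    refine h1.trans ?_
    have : 0 ≤ C * (1 + L) ^ n * (t ^ n * ((1 + L) ^ γ * (t / R) ^ γ)) := by positivity
    nlinarith

end BallGrowth

end BallJohnNirenberg
section BallComparison

variable {E : Type*} [NormedAddCommGroup E] [NormedSpace ℝ E] [FiniteDimensional ℝ E]
  [MeasurableSpace E] [BorelSpace E]

/-- A sum of powers of dyadic numbers bounded by one is controlled by a geometric series. -/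
lemma sum_dyadic_rpow_le {γ : ℝ} (hγ : 0 < γ) {a : ℝ} (ha : 0 < a) (s : Finset ℕ)
    (hs : ∀ k ∈ s, 2 ^ k * a ≤ 1) :
    ∑ k ∈ s, (2 ^ k * a) ^ γ ≤ (1 - (2 : ℝ) ^ (-γ))⁻¹ := by
  set w : ℝ := (2 : ℝ) ^ (-γ) with hw
  have hw0 : 0 < w := by positivity
  have hw1 : w < 1 := Real.rpow_lt_one_of_one_lt_of_neg one_lt_two (by linarith)
  rcases s.eq_empty_or_nonempty with rfl | hne
  · simpa using hw1.le
  set K := s.max' hne with hK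
  have hKs : 2 ^ K * a ≤ 1 := hs K (s.max'_mem hne)
  have hle : ∀ k ∈ s, k ≤ K := fun k hk => s.le_max' k hk
  have hterm : ∀ k ∈ s, (2 ^ k * a) ^ γ ≤ w ^ (K - k) := by
    intro k hk
    have h1 : 2 ^ k * a ≤ ((2 : ℝ) ^ (K - k))⁻¹ := by
      rw [← one_div, le_div_iff₀ (by positivity)]
      calc (2 : ℝ) ^ k * a * 2 ^ (K - k) = 2 ^ (k + (K - k)) * a := by rw [pow_add]; ring
        _ ≤ 1 := by rwa [Nat.add_sub_cancel' (hle k hk)]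
    refine (Real.rpow_le_rpow (by positivity) h1 hγ.le).trans_eq ?_
    rw [hw, ← Real.rpow_natCast _ (K - k), ← Real.rpow_natCast _ (K - k),
      ← Real.rpow_neg two_pos.le, ← Real.rpow_mul two_pos.le, ← Real.rpow_mul two_pos.le]
    congr 1
    ring
  calc ∑ k ∈ s, (2 ^ k * a) ^ γ ≤ ∑ k ∈ s, w ^ (K - k) := Finset.sum_le_sum hterm
    _ ≤ ∑ k ∈ Finset.range (K + 1), w ^ (K - k) :=
        Finset.sum_le_sum_of_subset_of_nonneg
          (fun k hk => Finset.mem_range.2 (Nat.lt_succ_of_le (hle k hk)))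
          fun _ _ _ => by positivity
    _ = ∑ k ∈ Finset.range (K + 1), w ^ k := by
        rw [← Finset.sum_range_reflect]
        refine Finset.sum_congr rfl fun k hk => ?_
        have := Finset.mem_range.1 hk
        congr 1
        omega
    _ ≤ ∑' k : ℕ, w ^ k :=
        (summable_geometric_of_lt_one hw0.le hw1).sum_le_tsum _ fun _ _ => by positivity
    _ = (1 - w)⁻¹ := tsum_geometric_of_lt_one hw0.le hw1

lemma DensityDecay.mono {μ : Measure E} {n : ℕ} {γ : ℝ} {x : E} {r r' R C C' : ℝ} (hr : 0 < r)
    (hrr : r ≤ r') (hC : C ≤ C') (h : DensityDecay μ n γ x r R C) :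
    DensityDecay μ n γ x r' R C' := by
  intro t hrt htR
  have ht : 0 < t := hr.trans_le (hrr.trans hrt)
  have hR : 0 < R := ht.trans_le htR
  refine (h t (hrr.trans hrt) htR).trans ?_
  have : 0 ≤ (t / R) ^ γ := Real.rpow_nonneg (by positivity) γ
  gcongr

lemma BallGrowth.sum_density_le {μ : Measure E} {n : ℕ} {ρ β γ C₀ : ℝ}
    (h : BallGrowth μ n ρ β γ C₀) {x : E} (hx : x ∈ μ.support) {r R C : ℝ} (hr : 0 < r)
    (hrR : r ≤ R) (hC : 0 ≤ C) (F : Finset ℝ)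
    (hF : ∀ t, r ≤ t → t ≤ R → ∃ q ∈ F, t ≤ q ∧ ballMass μ x t ≤ C * t ^ n * (t / q) ^ γ) :
    ∃ N : ℕ, 0 < N ∧ R ≤ 2 ^ N * r ∧
      ∑ k ∈ Finset.Icc 1 N, ballMass μ x (2 ^ k * r) / (2 ^ k * r) ^ n ≤
        C₀ + F.card * (C * (1 - (2 : ℝ) ^ (-γ))⁻¹) := by
  obtain ⟨i, hi1, hi2⟩ := exists_nat_pow_near ((one_le_div hr).2 hrR) one_lt_two
  rw [le_div_iff₀ hr] at hi1
  rw [div_lt_iff₀ hr] at hi2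
  refine ⟨i + 1, i.succ_pos, hi2.le, ?_⟩
  rw [Finset.sum_Icc_succ_top (by omega), add_comm]
  refine add_le_add ?_ ?_
  · rw [div_le_iff₀ (by positivity)]
    exact h.mass_le x hx _ (by positivity)
  have hterm : ∀ k ∈ Finset.Icc 1 i, ballMass μ x (2 ^ k * r) / (2 ^ k * r) ^ n ≤
      ∑ q ∈ F, if 2 ^ k * r ≤ q then C * (2 ^ k * r / q) ^ γ else 0 := by
    intro k hk
    have hki : (2 : ℝ) ^ k * r ≤ 2 ^ i * r := by
      have := (Finset.mem_Icc.1 hk).2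
      gcongr
      exact one_le_two
    have hk1 : r ≤ 2 ^ k * r := le_mul_of_one_le_left hr.le (one_le_pow₀ one_le_two)
    obtain ⟨q, hq, htq, hm⟩ := hF (2 ^ k * r) hk1 (hki.trans hi1)
    have hle : ballMass μ x (2 ^ k * r) / (2 ^ k * r) ^ n ≤ C * (2 ^ k * r / q) ^ γ := by
      rw [div_le_iff₀ (by positivity)]
      exact hm.trans_eq (by ring)
    refine hle.trans ?_
    refine le_trans ?_ (Finset.single_le_sum (f := fun q : ℝ =>
      if 2 ^ k * r ≤ q then C * (2 ^ k * r / q) ^ γ else 0) (fun q' _ => ?_) hq)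
    · simp [htq]
    · split_ifs with hc
      · have : 0 < q' := lt_of_lt_of_le (by positivity) hc
        positivity
      · exact le_rfl
  refine (Finset.sum_le_sum hterm).trans ?_
  rw [Finset.sum_comm, ← nsmul_eq_mul]
  refine Finset.sum_le_card_nsmul _ _ _ fun q _ => ?_
  rw [← Finset.sum_filter, ← Finset.mul_sum]
  refine mul_le_mul_of_nonneg_left ?_ hC
  by_cases hq : 0 < q
  · have h2 : ∀ k : ℕ, 2 ^ k * r / q = 2 ^ k * (r / q) := fun k => mul_div_assoc _ _ _
    simp_rw [h2]
    refine sum_dyadic_rpow_le h.γ_pos (by positivity) _ fun k hk => ?_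
    rw [← h2, div_le_one hq]
    exact (Finset.mem_filter.1 hk).2
  · rw [Finset.filter_false_of_mem fun k _ hc => hq (lt_of_lt_of_le (by positivity) hc),
      Finset.sum_empty, inv_nonneg, sub_nonneg]
    exact Real.rpow_le_one_of_one_le_of_nonpos one_le_two (by linarith [h.γ_pos])

namespace BallOsc

variable {μ : Measure E} [IsLocallyFiniteMeasure μ] {n : ℕ} {η ρ β γ C₀ r₀ : ℝ} {f : E → ℝ}

lemma integrableOn (hf : BallOsc μ n η ρ β r₀ f) (x : E) (r : ℝ) :
    IntegrableOn f (closedBall x r) μ := by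
  have : ProperSpace E := FiniteDimensional.proper_real E
  exact hf.locInt.integrableOn_isCompact (isCompact_closedBall x r)

lemma integrableOn_sub (hf : BallOsc μ n η ρ β r₀ f) (c : ℝ) (x : E) (r : ℝ) :
    IntegrableOn (fun y => |f y - c|) (closedBall x r) μ :=
  ((hf.integrableOn x r).sub
    (integrableOn_const (measure_closedBall_ne_top x r))).abs

/-- Changing the constant changes the oscillation in a controlled way. -/
lemma integral_sub_le (hf : BallOsc μ n η ρ β r₀ f) (c c' : ℝ) (x : E) (r : ℝ) :
    ∫ y in closedBall x r, |f y - c| ∂μ ≤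
      (∫ y in closedBall x r, |f y - c'| ∂μ) + |c' - c| * ballMass μ x r := by
  have h1 : ∫ y in closedBall x r, |f y - c| ∂μ ≤
      ∫ y in closedBall x r, (|f y - c'| + |c' - c|) ∂μ :=
    setIntegral_mono (hf.integrableOn_sub c x r)
      ((hf.integrableOn_sub c' x r).add (integrableOn_const (measure_closedBall_ne_top x r)))
      fun y => abs_sub_le _ _ _
  rw [integral_add (hf.integrableOn_sub c' x r)
    (integrableOn_const (measure_closedBall_ne_top x r)), setIntegral_const, smul_eq_mul,
    mul_comm (μ.real _)] at h1
  exact h1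

/-- Two constants from which `f` has small oscillation on the same ball are close. -/
lemma abs_sub_mul_mass_le (hf : BallOsc μ n η ρ β r₀ f) (c c' : ℝ) (x : E) (r : ℝ) :
    |c - c'| * ballMass μ x r ≤
      (∫ y in closedBall x r, |f y - c| ∂μ) + ∫ y in closedBall x r, |f y - c'| ∂μ := by
  have h1 : ∫ _ in closedBall x r, |c - c'| ∂μ ≤
      ∫ y in closedBall x r, (|f y - c| + |f y - c'|) ∂μ :=
    setIntegral_mono (integrableOn_const (measure_closedBall_ne_top x r))
      ((hf.integrableOn_sub c x r).add (hf.integrableOn_sub c' x r))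
      fun y => by
        dsimp only
        rw [abs_sub_comm (f y) c]
        exact abs_sub_le _ _ _
  rw [integral_add (hf.integrableOn_sub c x r) (hf.integrableOn_sub c' x r), setIntegral_const,
    smul_eq_mul, mul_comm] at h1
  exact h1

lemma abs_avg_le (hf : BallOsc μ n η ρ β r₀ f) (hη : η ≤ ρ) {x : E} (hx : x ∈ μ.support) {r : ℝ}
    (hr0 : 0 < r) (hr : r₀ < r) (hd : BallDoubling μ ρ β x r) : |ballAvg μ f x r| ≤ β :=
  abs_integral_ball_le_of_abs_le f x r
    ((hf.large_le x hx r hr).trans ((ballMass_mono x (by gcongr)).trans hd)) (ballMass_pos hx hr0)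

lemma osc_doubling (hf : BallOsc μ n η ρ β r₀ f) (h : BallGrowth μ n ρ β γ C₀) (hη : η ≤ ρ)
    {x : E} (hx : x ∈ μ.support) {r : ℝ} (hr : 0 < r) (hd : BallDoubling μ ρ β x r) :
    ∫ y in closedBall x r, |f y - ballAvg μ f x r| ∂μ ≤ 2 * β * ballMass μ x r := by
  have hm := ballMass_pos hx hr
  have hβ := h.one_lt_β
  have hηρ : ballMass μ x (η * r) ≤ β * ballMass μ x r :=
    (ballMass_mono x (by gcongr)).trans hd
  by_cases hr0 : r ≤ r₀
  · have := hf.osc_le x hx r hr hr0 0 (by simpa using hd) (by simp)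
    simp only [pow_zero, one_mul] at this
    nlinarith
  · push Not at hr0
    have h1 := hf.integral_sub_le (ballAvg μ f x r) 0 x r
    have h2 := hf.abs_avg_le hη hx hr hr0 hd
    have h3 := hf.large_le x hx r hr0
    simp only [sub_zero, zero_sub, abs_neg] at h1
    nlinarith

lemma avg_sub_le_sum (hf : BallOsc μ n η ρ β r₀ f) (h : BallGrowth μ n ρ β γ C₀) (hη : η ≤ ρ)
    {x y : E} (hx : x ∈ μ.support) (hy : y ∈ μ.support) {r s : ℝ} (hr : 0 < r) (hrs : r ≤ s)
    (hsub : closedBall x r ⊆ closedBall y s) (hdx : BallDoubling μ ρ β x r)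
    (hdy : BallDoubling μ ρ β y s) {N : ℕ} (hN : 0 < N) (hsN : s ≤ 2 ^ N * r) :
    |ballAvg μ f x r - ballAvg μ f y s| ≤
      (1 + 2 * β) * (1 + ∑ k ∈ Finset.Icc 1 N, ballMass μ x (2 ^ k * r) / (2 ^ k * r) ^ n) := by
  have hβ := h.one_lt_β
  have hsum : 0 ≤ ∑ k ∈ Finset.Icc 1 N, ballMass μ x (2 ^ k * r) / (2 ^ k * r) ^ n :=
    Finset.sum_nonneg fun k _ => div_nonneg (ballMass_nonneg _ _) (by positivity)
  by_cases hr0 : r ≤ r₀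
  · refine (hf.avg_sub_le x hx y hy r s hr hr0 hrs hsub hdx hdy N hN hsN).trans ?_
    exact le_mul_of_one_le_left (by linarith) (by linarith)
  · push Not at hr0
    have h1 := hf.abs_avg_le hη hx hr hr0 hdx
    have h2 := hf.abs_avg_le hη hy (hr.trans_le hrs) (hr0.trans_le hrs) hdy
    have h3 := abs_sub (ballAvg μ f x r) (ballAvg μ f y s)
    nlinarith

lemma avg_sub_le_of_decay (hf : BallOsc μ n η ρ β r₀ f) (h : BallGrowth μ n ρ β γ C₀)
    (hη : η ≤ ρ) {x y : E} (hx : x ∈ μ.support) (hy : y ∈ μ.support) {r s C : ℝ} (hr : 0 < r)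
    (hrs : r ≤ s) (hC : 0 ≤ C) (hsub : closedBall x r ⊆ closedBall y s)
    (hdx : BallDoubling μ ρ β x r) (hdy : BallDoubling μ ρ β y s) (F : Finset ℝ)
    (hF3 : F.card ≤ 3)
    (hF : ∀ t, r ≤ t → t ≤ s → ∃ q ∈ F, t ≤ q ∧ ballMass μ x t ≤ C * t ^ n * (t / q) ^ γ) :
    |ballAvg μ f x r - ballAvg μ f y s| ≤
      (1 + 2 * β) * (1 + (C₀ + 3 * (C * (1 - (2 : ℝ) ^ (-γ))⁻¹))) := by
  obtain ⟨N, hN, hsN, hsum⟩ := h.sum_density_le hx hr hrs hC F hF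
  have hβ := h.one_lt_β
  refine (hf.avg_sub_le_sum h hη hx hy hr hrs hsub hdx hdy hN hsN).trans ?_
  have h1 : (0 : ℝ) ≤ (1 - (2 : ℝ) ^ (-γ))⁻¹ := by
    rw [inv_nonneg, sub_nonneg]
    exact Real.rpow_le_one_of_one_le_of_nonpos one_le_two (by linarith [h.γ_pos])
  have h2 : (F.card : ℝ) ≤ 3 := by exact_mod_cast hF3
  gcongr
  exact hsum.trans (by gcongr)

end BallOsc

namespace BallGrowth

variable {μ : Measure E} [IsLocallyFiniteMeasure μ] {n : ℕ} {ρ β γ C₀ : ℝ}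

/-- Comparison of doubling averages over concentric balls, when the density decays in between. -/
lemma doublingAvg_sub_le_of_decay (h : BallGrowth μ n ρ β γ C₀) {η : ℝ} (hη : η ≤ ρ) (r₀ : ℝ)
    {C : ℝ} (hC : 0 ≤ C) : ∃ C' : ℝ, 0 ≤ C' ∧ ∀ f, BallOsc μ n η ρ β r₀ f →
      ∀ x ∈ μ.support, ∀ r R, 0 < r → r ≤ R → DensityDecay μ n γ x r R C →
        |doublingAvg μ ρ β f x r - doublingAvg μ ρ β f x R| ≤ C' := by
  have hβ := h.one_lt_β
  have hC0 := h.C₀_pos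
  have hγ := h.γ_pos
  have hw : (0 : ℝ) ≤ (1 - (2 : ℝ) ^ (-γ))⁻¹ := by
    rw [inv_nonneg, sub_nonneg]
    exact Real.rpow_le_one_of_one_le_of_nonpos one_le_two (by linarith)
  set D := C + β * C₀ with hD
  have hβC : 0 ≤ β * C₀ := by positivity
  refine ⟨(1 + 2 * β) * (1 + (C₀ + 3 * (D * (1 - (2 : ℝ) ^ (-γ))⁻¹))), by positivity, ?_⟩
  intro f hf x hx r R hr hrR hd
  have hR := hr.trans_le hrR
  have hrp := h.le_doublingRadius x hr
  have hRq := h.le_doublingRadius x hR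
  have hdp := h.decay_doublingRadius hx hr
  have hdq := h.decay_doublingRadius hx hR
  have hDp := h.doubling_doublingRadius hx hr
  have hDq := h.doubling_doublingRadius hx hR
  unfold doublingAvg
  set p := doublingRadius μ ρ β x r
  set q := doublingRadius μ ρ β x R
  rcases le_total p q with hpq | hqp
  · refine hf.avg_sub_le_of_decay h hη hx hx (hr.trans_le hrp) hpq (by positivity)
      (closedBall_subset_closedBall hpq) hDp hDq {R, q} (Finset.card_le_two.trans (by norm_num)) ?_
    intro t hpt htq
    rcases le_total t R with htR | hRt
    · exact ⟨R, by simp, htR,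
        hd.mono hr le_rfl (by linarith : C ≤ D) t (hrp.trans hpt) htR⟩
    · exact ⟨q, by simp, htq, hdq.mono hR le_rfl (by linarith : _ ≤ D) t hRt htq⟩
  · rw [abs_sub_comm]
    refine hf.avg_sub_le_of_decay h hη hx hx (hR.trans_le hRq) hqp (by positivity)
      (closedBall_subset_closedBall hqp) hDq hDp {p} (by simp) ?_
    intro t hqt htp
    exact ⟨p, by simp, htp, hdp.mono hr le_rfl (by linarith : _ ≤ D) t
      (hrR.trans (hRq.trans hqt)) htp⟩

/-- Comparison of doubling averages over concentric balls with comparable radii. -/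
lemma doublingAvg_sub_le_of_le_mul (h : BallGrowth μ n ρ β γ C₀) {η : ℝ} (hη : η ≤ ρ) (r₀ : ℝ)
    {L : ℝ} (hL : 0 < L) : ∃ C' : ℝ, 0 ≤ C' ∧ ∀ f, BallOsc μ n η ρ β r₀ f →
      ∀ x ∈ μ.support, ∀ r R, 0 < r → r ≤ R → R ≤ L * r →
        |doublingAvg μ ρ β f x r - doublingAvg μ ρ β f x R| ≤ C' := by
  have hC0 := h.C₀_pos
  obtain ⟨C', hC', H⟩ := h.doublingAvg_sub_le_of_decay hη r₀ (C := C₀ * L ^ γ) (by positivity)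
  exact ⟨C', hC', fun f hf x hx r R hr hrR hRL =>
    H f hf x hx r R hr hrR (h.decay_of_le_mul hx hr hL hRL)⟩

/-- Comparison of doubling averages over balls with equal radii and nearby centers. -/
lemma doublingAvg_sub_le_of_dist_le (h : BallGrowth μ n ρ β γ C₀) {η : ℝ} (hη : η ≤ ρ) (r₀ : ℝ)
    {L : ℝ} (hL : 0 ≤ L) : ∃ C' : ℝ, 0 ≤ C' ∧ ∀ f, BallOsc μ n η ρ β r₀ f →
      ∀ x ∈ μ.support, ∀ y ∈ μ.support, ∀ r, 0 < r → dist x y ≤ L * r →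
        |doublingAvg μ ρ β f x r - doublingAvg μ ρ β f y r| ≤ C' := by
  have hβ := h.one_lt_β
  have hC0 := h.C₀_pos
  have hγ := h.γ_pos
  have hL1 : 0 < 1 + L := by linarith
  have hw : (0 : ℝ) ≤ (1 - (2 : ℝ) ^ (-γ))⁻¹ := by
    rw [inv_nonneg, sub_nonneg]
    exact Real.rpow_le_one_of_one_le_of_nonpos one_le_two (by linarith)
  set D := (β * C₀ * (1 + L) ^ n + C₀) * (1 + L) ^ γ with hD
  have hD0 : 0 ≤ D := by positivity
  have hD1 : C₀ * (1 + L) ^ γ ≤ D := by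
    rw [hD]
    gcongr
    exact le_add_of_nonneg_left (by positivity)
  obtain ⟨C₁, hC₁, H⟩ := h.doublingAvg_sub_le_of_le_mul hη r₀ hL1
  refine ⟨(1 + 2 * β) * (1 + (C₀ + 3 * (D * (1 - (2 : ℝ) ^ (-γ))⁻¹))) + C₁, by positivity, ?_⟩
  intro f hf
  suffices key : ∀ x ∈ μ.support, ∀ y ∈ μ.support, ∀ r, 0 < r → dist x y ≤ L * r →
      doublingRadius μ ρ β x r ≤ doublingRadius μ ρ β y r →
      |doublingAvg μ ρ β f x r - doublingAvg μ ρ β f y r| ≤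
        (1 + 2 * β) * (1 + (C₀ + 3 * (D * (1 - (2 : ℝ) ^ (-γ))⁻¹))) + C₁ by
    intro x hx y hy r hr hxy
    rcases le_total (doublingRadius μ ρ β x r) (doublingRadius μ ρ β y r) with hpq | hqp
    · exact key x hx y hy r hr hxy hpq
    · rw [abs_sub_comm]
      exact key y hy x hx r hr (by rwa [dist_comm]) hqp
  intro x hx y hy r hr hxy hpq
  have hrp := h.le_doublingRadius x hr
  have hrq := h.le_doublingRadius y hr
  have hdq := h.decay_doublingRadius hy hr
  have hDp := h.doubling_doublingRadius hx hr
  have hDq := h.doubling_doublingRadius hy hr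
  unfold doublingAvg
  set p := doublingRadius μ ρ β x r
  set q := doublingRadius μ ρ β y r
  have hq : 0 < q := hr.trans_le hrq
  have hLq : q ≤ (1 + L) * q := by nlinarith
  have hLq0 : 0 < (1 + L) * q := by positivity
  have h1 := H f hf y hy q ((1 + L) * q) hq hLq le_rfl
  have hqR := h.le_doublingRadius y hLq0
  have hdR := h.decay_doublingRadius hy hLq0
  have hDR := h.doubling_doublingRadius hy hLq0
  rw [doublingAvg, doublingAvg, doublingRadius_eq_self hDq] at h1
  set R := doublingRadius μ ρ β y ((1 + L) * q)
  have hLr : L * r ≤ L * q := by gcongr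
  have h2 : |ballAvg μ f x p - ballAvg μ f y R| ≤
      (1 + 2 * β) * (1 + (C₀ + 3 * (D * (1 - (2 : ℝ) ^ (-γ))⁻¹))) := by
    refine hf.avg_sub_le_of_decay h hη hx hy (hr.trans_le hrp) (by linarith) hD0
      (closedBall_subset_closedBall' (by nlinarith)) hDp hDR {q, (1 + L) * q, R}
      Finset.card_le_three ?_
    intro t hpt htR
    rcases le_total t q with htq | hqt
    · exact ⟨q, by simp, htq,
        h.decay_transfer hx hr hL (by positivity) hxy hdq t (hrp.trans hpt) htq⟩
    rcases le_total t ((1 + L) * q) with htq | hLqt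
    · exact ⟨(1 + L) * q, by simp, htq,
        ((h.decay_of_le_mul hx hq hL1 le_rfl).mono hq le_rfl hD1) t hqt htq⟩
    · refine ⟨R, by simp, htR,
        h.decay_transfer hx hLq0 hL (by positivity) ?_ hdR t hLqt htR⟩
      nlinarith [mul_nonneg hL (mul_nonneg hL hq.le)]
  calc |ballAvg μ f x p - ballAvg μ f y q|
      ≤ |ballAvg μ f x p - ballAvg μ f y R| + |ballAvg μ f y R - ballAvg μ f y q| :=
        abs_sub_le _ _ _
    _ ≤ _ := add_le_add h2 (by rwa [abs_sub_comm])

end BallGrowth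

end BallComparison
section BallOscillation

variable {E : Type*} [NormedAddCommGroup E] [NormedSpace ℝ E] [FiniteDimensional ℝ E]
  [MeasurableSpace E] [BorelSpace E]

/-- A subset of a ball is covered by a bounded number of smaller balls centered in it. -/
lemma exists_finset_cover_closedBall (E : Type*) [NormedAddCommGroup E] [NormedSpace ℝ E]
    [FiniteDimensional ℝ E] {κ : ℝ} (hκ : 0 < κ) :
    ∃ N : ℕ, ∀ (x : E) (R : ℝ), 0 < R → ∀ A ⊆ closedBall x R,
      ∃ t : Finset E, (∀ y ∈ t, y ∈ A) ∧ t.card ≤ N ∧ A ⊆ ⋃ y ∈ t, closedBall y (κ * R) := by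
  classical
  have : ProperSpace E := FiniteDimensional.proper_real E
  obtain ⟨t₀, -, hfin, hcov⟩ := (isCompact_closedBall (0 : E) 1).finite_cover_balls (half_pos hκ)
  refine ⟨hfin.toFinset.card, fun x R hR A hA => ?_⟩
  let P : E → Prop := fun z => ∃ y ∈ A, dist y (x + R • z) ≤ κ / 2 * R
  let g : E → E := fun z => if hz : P z then hz.choose else x
  refine ⟨(hfin.toFinset.filter P).image g, ?_, Finset.card_image_le.trans
    (Finset.card_filter_le _ _), ?_⟩
  · intro y hy
    obtain ⟨z, hz, rfl⟩ := Finset.mem_image.1 hy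
    have hPz := (Finset.mem_filter.1 hz).2
    simp only [g, dif_pos hPz]
    exact hPz.choose_spec.1
  · intro y hy
    have hyR := hA hy
    have h1 : R⁻¹ • (y - x) ∈ closedBall (0 : E) 1 := by
      rw [mem_closedBall_zero_iff, norm_smul, norm_inv, Real.norm_of_nonneg hR.le,
        inv_mul_le_iff₀ hR, mul_one, ← dist_eq_norm]
      exact hyR
    obtain ⟨z, hz, hyz⟩ := mem_iUnion₂.1 (hcov h1)
    have h2 : dist y (x + R • z) ≤ κ / 2 * R := by
      have : y - (x + R • z) = R • (R⁻¹ • (y - x) - z) := by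
        rw [smul_sub, smul_inv_smul₀ hR.ne']
        abel
      rw [dist_eq_norm, this, norm_smul, Real.norm_of_nonneg hR.le, ← dist_eq_norm, mul_comm]
      exact mul_le_mul_of_nonneg_right (mem_ball.1 hyz).le hR.le
    have hPz : P z := ⟨y, hy, h2⟩
    refine mem_iUnion₂.2 ⟨g z, Finset.mem_image.2
      ⟨z, Finset.mem_filter.2 ⟨hfin.mem_toFinset.2 hz, hPz⟩, rfl⟩, ?_⟩
    simp only [g, dif_pos hPz]
    have h3 := hPz.choose_spec.2
    have h4 := dist_triangle_right y hPz.choose (x + R • z)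
    rw [mem_closedBall]
    linarith

/-- Two geometric bounds with exponents `a + γ` and `0` give one with exponent `a`. -/
lemma le_mul_rpow_of_le {a γ u v M K : ℝ} (ha : 0 < a) (hγ : 0 < γ) (hu : 0 < u) (hM : 0 ≤ M)
    (hK : 0 < K) (h1 : v ≤ u ^ (a + γ) * M) (h2 : v ≤ K * (K ^ γ⁻¹) ^ a * M) :
    v ≤ K * u ^ a * M := by
  rcases le_total (u ^ γ) K with h | h
  · refine h1.trans ?_
    rw [Real.rpow_add hu, mul_comm (u ^ a)]
    gcongr
  · refine h2.trans ?_
    have : K ^ γ⁻¹ ≤ u := by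
      rw [← Real.rpow_rpow_inv hu.le hγ.ne']
      exact Real.rpow_le_rpow hK.le h (inv_nonneg.2 hγ.le)
    gcongr

namespace BallGrowth

variable {μ : Measure E} [IsLocallyFiniteMeasure μ] {n : ℕ} {ρ β γ C₀ : ℝ}

/-- If each ball `B(x, 2 ^ k r)`, `k < b`, carries little mass compared with its doubling
ancestor, then the density decays between `r` and `2 ^ b r`. -/
lemma decay_of_sparse (h : BallGrowth μ n ρ β γ C₀) {x : E} (hx : x ∈ μ.support) {r : ℝ}
    (hr : 0 < r) {b : ℕ}
    (hsp : ∀ k < b, ballMass μ x (2 ^ k * r) ≤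
      (2 : ℝ) ^ (-((n : ℝ) + γ)) * (((2 : ℝ) ^ (-((n : ℝ) + γ))) ^ γ⁻¹) ^ ((n : ℝ) + γ) *
        ballMass μ x (doublingRadius μ ρ β x (2 ^ k * r))) :
    DensityDecay μ n γ x r (2 ^ b * r) (C₀ * 2 ^ n * 2 ^ γ) := by
  have hγ := h.γ_pos
  have hC0 := h.C₀_pos
  have hρ := h.ρ_pos
  have key : ∀ d k : ℕ, b - k = d → ballMass μ x (2 ^ k * r) ≤
      C₀ * (2 ^ k * r) ^ n * ((2 ^ k * r) / (2 ^ b * r)) ^ γ := by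
    intro d
    induction d using Nat.strong_induction_on with
    | _ d ih =>
      intro k hd
      have hrk : 0 < 2 ^ k * r := by positivity
      rcases le_or_gt b k with hbk | hkb
      · refine (h.mass_le x hx _ hrk).trans (le_mul_of_one_le_right (by positivity) ?_)
        refine Real.one_le_rpow ?_ hγ.le
        rw [one_le_div (by positivity)]
        gcongr
        exact one_le_two
      · obtain ⟨j, hj, -, hjk⟩ := h.exists_doublingRadius hx hrk
        have h1 := h.pow_mul_mass_le (Nat.zero_le j) fun k' hk' => not_doubling (hjk k' hk')
        rw [← hj, Nat.sub_zero, pow_zero, one_mul, h.β_pow] at h1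
        have h2 := hsp k hkb
        have hle := h.le_doublingRadius x hrk
        set H := doublingRadius μ ρ β x (2 ^ k * r) with hH
        have hHpos : 0 < H := hrk.trans_le hle
        obtain ⟨i, hi1, hi2⟩ := exists_nat_pow_near ((one_le_div hrk).2 hle) one_lt_two
        have hi2' : H ≤ 2 ^ (k + (i + 1)) * r := by
          rw [div_lt_iff₀ hrk] at hi2
          refine hi2.le.trans_eq ?_
          rw [pow_add 2 k]
          ring
        have hu : (2 ^ k * r) / H = (ρ ^ j)⁻¹ := by
          rw [hj]
          field_simp
        have h3 : ballMass μ x (2 ^ k * r) ≤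
            ((2 ^ k * r) / H) ^ (((n : ℝ) + γ) + γ) * ballMass μ x H := by
          rw [hu, Real.inv_rpow (by positivity), ← div_eq_inv_mul, le_div_iff₀ (by positivity),
            mul_comm, add_assoc, ← two_mul]
          exact h1
        have h4 := le_mul_rpow_of_le (by positivity) hγ (by positivity) (ballMass_nonneg x H)
          (by positivity) h3 h2
        have h5 := ih (b - (k + (i + 1))) (by omega) (k + (i + 1)) rfl
        have hrk' : 0 < 2 ^ (k + (i + 1)) * r := by positivity
        have h6 : (2 : ℝ) ^ (-((n : ℝ) + γ)) * ((2 ^ k * r) / H) ^ ((n : ℝ) + γ) ≤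
            ((2 ^ k * r) / (2 ^ (k + (i + 1)) * r)) ^ ((n : ℝ) + γ) := by
          rw [Real.rpow_neg two_pos.le, ← Real.inv_rpow two_pos.le,
            ← Real.mul_rpow (by positivity) (by positivity)]
          refine Real.rpow_le_rpow (by positivity) ?_ (by positivity)
          rw [le_div_iff₀ hrk] at hi1
          rw [← div_eq_inv_mul, div_div, div_le_div_iff_of_pos_left hrk (by positivity) hrk']
          calc 2 ^ (k + (i + 1)) * r = 2 ^ i * (2 ^ k * r) * 2 := by
                rw [pow_add, pow_succ]
                ring
            _ ≤ H * 2 := by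
                gcongr
        set s := 2 ^ k * r
        set s' := 2 ^ (k + (i + 1)) * r
        set R := 2 ^ b * r with hR
        have hRpos : 0 < R := by positivity
        calc ballMass μ x s ≤ (s / s') ^ ((n : ℝ) + γ) * ballMass μ x s' := by
              refine h4.trans ?_
              have := ballMass_mono (μ := μ) x hi2'
              have := ballMass_nonneg (μ := μ) x H
              gcongr
          _ ≤ (s / s') ^ ((n : ℝ) + γ) * (C₀ * s' ^ n * (s' / R) ^ γ) := by gcongr
          _ = C₀ * s ^ n * (s / R) ^ γ := by
              have e : s / R = s / s' * (s' / R) := by field_simp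
              rw [e, Real.mul_rpow (by positivity) (by positivity), Real.rpow_add (by positivity),
                Real.rpow_natCast, div_pow]
              field_simp
  intro t hrt htR
  have ht : 0 < t := hr.trans_le hrt
  obtain ⟨i, hi1, hi2⟩ := exists_nat_pow_near ((one_le_div hr).2 hrt) one_lt_two
  rw [le_div_iff₀ hr] at hi1
  rw [div_lt_iff₀ hr] at hi2
  have h1 : 2 ^ (i + 1) * r ≤ 2 * t := by
    rw [pow_succ']
    linarith
  calc ballMass μ x t ≤ ballMass μ x (2 ^ (i + 1) * r) := ballMass_mono x hi2.le
    _ ≤ _ := key _ (i + 1) rfl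
    _ ≤ C₀ * (2 * t) ^ n * ((2 * t) / (2 ^ b * r)) ^ γ := by gcongr
    _ = C₀ * 2 ^ n * 2 ^ γ * t ^ n * (t / (2 ^ b * r)) ^ γ := by
        rw [mul_div_assoc, Real.mul_rpow two_pos.le (by positivity), mul_pow]
        ring

/-- The mean value over the first doubling dyadic dilate is comparable to the doubling average. -/
lemma doublingAvg_sub_dyadic_le (h : BallGrowth μ n ρ β γ C₀) {η : ℝ} (hη : η ≤ ρ) (r₀ : ℝ) :
    ∃ C : ℝ, 0 ≤ C ∧ ∀ f, BallOsc μ n η ρ β r₀ f → ∀ x ∈ μ.support, ∀ r, 0 < r → r ≤ r₀ →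
      ∀ N : ℕ, BallDoubling μ ρ β x (2 ^ N * r) →
      (∀ k < N, ¬ BallDoubling μ ρ β x (2 ^ k * r)) →
      |doublingAvg μ ρ β f x r - ballAvg μ f x (2 ^ N * r)| ≤ C := by
  classical
  have hβ := h.one_lt_β
  have hC0 := h.C₀_pos
  have hρ := h.ρ_pos
  obtain ⟨C₁, hC₁, H⟩ := h.doublingAvg_sub_le_of_decay hη r₀ (C := C₀ * 2 ^ n * 2 ^ γ)
    (by positivity)
  set ε : ℝ := (2 : ℝ) ^ (-((n : ℝ) + γ)) * (((2 : ℝ) ^ (-((n : ℝ) + γ))) ^ γ⁻¹) ^ ((n : ℝ) + γ)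
    with hε
  have hε0 : 0 < ε := by positivity
  set A := max (2 * β) ((1 + 2 * β) / ε) with hA
  have hA0 : 0 ≤ A := le_max_of_le_left (by linarith)
  refine ⟨A + C₁, by positivity, ?_⟩
  intro f hf x hx r hr hr0 N hN hlt
  set g := ballAvg μ f x (2 ^ N * r) with hg
  have hgN : doublingAvg μ ρ β f x (2 ^ N * r) = g := by
    rw [doublingAvg, doublingRadius_eq_self hN]
  have hex : ∃ k : ℕ, |doublingAvg μ ρ β f x (2 ^ k * r) - g| ≤ A :=
    ⟨N, by rw [hgN, sub_self, abs_zero]; exact hA0⟩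
  set b := Nat.find hex with hb
  have hbA : |doublingAvg μ ρ β f x (2 ^ b * r) - g| ≤ A := Nat.find_spec hex
  have hbN : b ≤ N := Nat.find_min' hex (by rw [hgN, sub_self, abs_zero]; exact hA0)
  have hsp : ∀ k < b, ballMass μ x (2 ^ k * r) ≤
      ε * ballMass μ x (doublingRadius μ ρ β x (2 ^ k * r)) := by
    intro k hkb
    have hkA : A < |doublingAvg μ ρ β f x (2 ^ k * r) - g| := not_le.1 (Nat.find_min hex hkb)
    have hrk : 0 < 2 ^ k * r := by positivity
    have hrN : 2 ^ k * r ≤ 2 ^ N * r := by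
      gcongr
      · exact one_le_two
      · omega
    have hkr0 : 2 ^ k * r ≤ r₀ := by
      by_contra! hc
      have h1 := hf.abs_avg_le hη hx (hrk.trans_le hrN) (hc.trans_le hrN) hN
      have hle := h.le_doublingRadius x hrk
      have h2 := hf.abs_avg_le hη hx (hrk.trans_le hle) (hc.trans_le hle)
        (h.doubling_doublingRadius hx hrk)
      have h3 := abs_sub (doublingAvg μ ρ β f x (2 ^ k * r)) g
      have h4 : 2 * β ≤ A := le_max_left _ _
      rw [← doublingAvg] at h2
      rw [← hg] at h1
      linarith
    obtain ⟨j, hj, hdj, hjk⟩ := h.exists_doublingRadius hx hrk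
    have hj0 : j ≠ 0 := by
      rintro rfl
      exact hlt k (by omega) (by simpa using hdj)
    have hle : ρ * (2 ^ k * r) ≤ doublingRadius μ ρ β x (2 ^ k * r) := by
      rw [hj]
      gcongr
      exact le_self_pow₀ h.one_lt_ρ.le hj0
    set a := doublingAvg μ ρ β f x (2 ^ k * r) with ha
    have h1 : ∫ y in closedBall x (2 ^ k * r), |f y - g| ∂μ ≤
        ballMass μ x (doublingRadius μ ρ β x (2 ^ k * r)) := by
      have e : 2 ^ (N - k) * (2 ^ k * r) = 2 ^ N * r := by
        rw [← mul_assoc, ← pow_add, Nat.sub_add_cancel (by omega)]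
      have := hf.osc_le x hx (2 ^ k * r) hrk hkr0 (N - k) (by rwa [e]) (by
        intro i hi
        rw [← mul_assoc, ← pow_add]
        exact hlt _ (by omega))
      rw [e] at this
      exact this.trans (ballMass_mono x (le_trans (by gcongr) hle))
    have hHpos : 0 < doublingRadius μ ρ β x (2 ^ k * r) :=
      hrk.trans_le (h.le_doublingRadius x hrk)
    have h2 : ∫ y in closedBall x (2 ^ k * r), |f y - a| ∂μ ≤
        2 * β * ballMass μ x (doublingRadius μ ρ β x (2 ^ k * r)) :=
      (setIntegral_mono_set (hf.integrableOn_sub a x _) (ae_of_all _ fun _ => abs_nonneg _)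
        (closedBall_subset_closedBall (h.le_doublingRadius x hrk)).eventuallyLE).trans
        (hf.osc_doubling h hη hx hHpos (h.doubling_doublingRadius hx hrk))
    have h3 := hf.abs_sub_mul_mass_le a g x (2 ^ k * r)
    have h4 : (1 + 2 * β) / ε < |a - g| := (le_max_right _ _).trans_lt hkA
    have hm := ballMass_pos hx hrk
    set m := ballMass μ x (2 ^ k * r)
    set M := ballMass μ x (doublingRadius μ ρ β x (2 ^ k * r))
    have h5 : (1 + 2 * β) / ε * m ≤ (1 + 2 * β) * M := by
      refine (mul_le_mul_of_nonneg_right h4.le hm.le).trans ?_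
      linarith
    rw [div_mul_eq_mul_div, div_le_iff₀ hε0, mul_assoc] at h5
    have := le_of_mul_le_mul_left h5 (by linarith)
    linarith
  have hd := h.decay_of_sparse hx hr hsp
  have h1 := H f hf x hx r (2 ^ b * r) hr (le_mul_of_one_le_left hr.le (one_le_pow₀ one_le_two)) hd
  have h2 := abs_sub_le (doublingAvg μ ρ β f x r) (doublingAvg μ ρ β f x (2 ^ b * r)) g
  linarith

/-- At a comparable scale, `f` has controlled oscillation around its doubling average. -/
lemma exists_radius_osc_le (h : BallGrowth μ n ρ β γ C₀) {η : ℝ} (hη : η ≤ ρ) (hη1 : 1 ≤ η)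
    (r₀ : ℝ) : ∃ C : ℝ, 0 ≤ C ∧ ∀ f, BallOsc μ n η ρ β r₀ f → ∀ x ∈ μ.support, ∀ s, 0 < s →
      ∃ r, s ≤ r ∧ r ≤ 2 * s ∧
        ∫ y in closedBall x r, |f y - doublingAvg μ ρ β f x r| ∂μ ≤
          C * ballMass μ x (η * r) := by
  classical
  have hβ := h.one_lt_β
  obtain ⟨C₁, hC₁, H⟩ := h.doublingAvg_sub_dyadic_le hη r₀
  refine ⟨1 + C₁ + β, by positivity, ?_⟩
  intro f hf x hx s hs
  have hle := h.le_doublingRadius x hs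
  have hD := h.doubling_doublingRadius hx hs
  set R := doublingRadius μ ρ β x s
  obtain ⟨m, hm1, hm2⟩ := exists_nat_pow_near ((one_le_div hs).2 hle) one_lt_two
  rw [le_div_iff₀ hs] at hm1
  rw [div_lt_iff₀ hs, pow_succ] at hm2
  set r := R / 2 ^ m with hr
  have hsr : s ≤ r := by
    rw [hr, le_div_iff₀ (by positivity)]
    linarith
  have hr2 : r ≤ 2 * s := by
    rw [hr, div_le_iff₀ (by positivity)]
    linarith
  have hmr : 2 ^ m * r = R := by
    rw [hr]
    field_simp
  have hr0 : 0 < r := hs.trans_le hsr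
  refine ⟨r, hsr, hr2, ?_⟩
  have hmass : ballMass μ x r ≤ ballMass μ x (η * r) :=
    ballMass_mono x (le_mul_of_one_le_left hr0.le hη1)
  have hpos := ballMass_nonneg (μ := μ) x r
  rcases le_or_gt r r₀ with hrr | hrr
  · have hex : ∃ N : ℕ, BallDoubling μ ρ β x (2 ^ N * r) := ⟨m, by rwa [hmr]⟩
    have h1 := hf.osc_le x hx r hr0 hrr (Nat.find hex) (Nat.find_spec hex)
      fun k hk => Nat.find_min hex hk
    have h2 := H f hf x hx r hr0 hrr (Nat.find hex) (Nat.find_spec hex)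
      fun k hk => Nat.find_min hex hk
    have h3 := hf.integral_sub_le (doublingAvg μ ρ β f x r)
      (ballAvg μ f x (2 ^ Nat.find hex * r)) x r
    rw [abs_sub_comm] at h2
    nlinarith
  · have hle' := h.le_doublingRadius x hr0
    have h1 := hf.abs_avg_le hη hx (hr0.trans_le hle') (hrr.trans_le hle')
      (h.doubling_doublingRadius hx hr0)
    rw [← doublingAvg] at h1
    have h2 := hf.large_le x hx r hrr
    have h3 := hf.integral_sub_le (doublingAvg μ ρ β f x r) 0 x r
    simp only [sub_zero, zero_sub, abs_neg] at h3
    nlinarith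

/-- The oscillation of `f` around its doubling average, on every ball. -/
lemma lintegral_sub_doublingAvg_le (h : BallGrowth μ n ρ β γ C₀) {η : ℝ} (hη : η ≤ ρ)
    (hη1 : 1 ≤ η) (r₀ : ℝ) {σ : ℝ} (hσ : 0 < σ) (hσρ : σ < ρ) :
    ∃ C : ℝ, 0 ≤ C ∧ ∀ f, BallOsc μ n η ρ β r₀ f → ∀ x ∈ μ.support, ∀ r, 0 < r →
      ∫⁻ y in closedBall x (σ * r), ‖f y - doublingAvg μ ρ β f x r‖ₑ ∂μ ≤
        ENNReal.ofReal C * μ (closedBall x (ρ * r)) := by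
  have hβ := h.one_lt_β
  set c := min (1 / 2) ((ρ - σ) / (2 * η)) with hc
  have hc0 : 0 < c := lt_min (by norm_num) (div_pos (by linarith) (by linarith))
  have hc1 : c ≤ 1 / 2 := min_le_left _ _
  have hc2 : σ + η * (2 * c) ≤ ρ := by
    have : c ≤ (ρ - σ) / (2 * η) := min_le_right _ _
    rw [le_div_iff₀ (by linarith)] at this
    linarith
  obtain ⟨C₁, hC₁, H₁⟩ := h.exists_radius_osc_le hη hη1 r₀
  obtain ⟨C₂, hC₂, H₂⟩ := h.doublingAvg_sub_le_of_le_mul hη r₀ (inv_pos.2 hc0)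
  obtain ⟨C₃, hC₃, H₃⟩ := h.doublingAvg_sub_le_of_dist_le hη r₀ (L := σ / c) (by positivity)
  obtain ⟨K, hK⟩ := exists_finset_cover_closedBall E (div_pos hc0 hσ)
  refine ⟨K * (C₁ + C₂ + C₃), by positivity, ?_⟩
  intro f hf x hx r hr
  obtain ⟨t, htA, htK, hcov⟩ := hK x (σ * r) (by positivity) (closedBall x (σ * r) ∩ μ.support)
    inter_subset_left
  have hcr : c / σ * (σ * r) = c * r := by field_simp
  rw [hcr] at hcov
  set a := doublingAvg μ ρ β f x r with ha
  have hball : ∀ y ∈ t, ∫⁻ z in closedBall y (c * r), ‖f z - a‖ₑ ∂μ ≤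
      ENNReal.ofReal (C₁ + C₂ + C₃) * μ (closedBall x (ρ * r)) := by
    intro y hy
    obtain ⟨hyx, hyS⟩ := htA y hy
    obtain ⟨s, hs1, hs2, hs⟩ := H₁ f hf y hyS (c * r) (by positivity)
    have hs0 : 0 < s := lt_of_lt_of_le (by positivity) hs1
    have hsr : s ≤ r := hs2.trans (by nlinarith)
    have h2 := H₂ f hf x hx s r hs0 hsr (by
      rw [← div_eq_inv_mul, le_div_iff₀ hc0]
      linarith)
    have h3 := H₃ f hf x hx y hyS s hs0 (by
      rw [dist_comm]
      refine (mem_closedBall.1 hyx).trans ?_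
      rw [div_mul_eq_mul_div, le_div_iff₀ hc0]
      nlinarith)
    have h4 : |doublingAvg μ ρ β f y s - a| ≤ C₂ + C₃ := by
      have := abs_sub_le (doublingAvg μ ρ β f y s) (doublingAvg μ ρ β f x s) a
      rw [abs_sub_comm] at h3
      linarith
    have h5 := hf.integral_sub_le a (doublingAvg μ ρ β f y s) y s
    have hm1 : ballMass μ y s ≤ ballMass μ y (η * s) :=
      ballMass_mono y (le_mul_of_one_le_left hs0.le hη1)
    have hm2 : ballMass μ y (η * s) ≤ ballMass μ x (ρ * r) := by
      refine ballMass_le_of_subset (closedBall_subset_closedBall' ?_)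
      have := mem_closedBall.1 hyx
      nlinarith
    have hm0 := ballMass_nonneg (μ := μ) y s
    have h6 : ∫ z in closedBall y s, |f z - a| ∂μ ≤ (C₁ + C₂ + C₃) * ballMass μ x (ρ * r) := by
      refine h5.trans ?_
      calc _ ≤ C₁ * ballMass μ x (ρ * r) + (C₂ + C₃) * ballMass μ x (ρ * r) := by
            refine add_le_add (hs.trans (by gcongr)) ?_
            gcongr
            exact hm1.trans hm2
        _ = _ := by ring
    calc ∫⁻ z in closedBall y (c * r), ‖f z - a‖ₑ ∂μ
        ≤ ∫⁻ z in closedBall y s, ‖f z - a‖ₑ ∂μ :=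
          lintegral_mono_set (closedBall_subset_closedBall hs1)
      _ = ENNReal.ofReal (∫ z in closedBall y s, ‖f z - a‖ ∂μ) :=
          (ofReal_integral_norm_eq_lintegral_enorm ((hf.integrableOn y s).sub
            (integrableOn_const (measure_closedBall_ne_top y s)))).symm
      _ ≤ ENNReal.ofReal ((C₁ + C₂ + C₃) * ballMass μ x (ρ * r)) := ENNReal.ofReal_le_ofReal h6
      _ = _ := by rw [ENNReal.ofReal_mul (by positivity), ofReal_ballMass]
  have hsub : closedBall x (σ * r) ⊆ (⋃ y : t, closedBall (y : E) (c * r)) ∪ μ.supportᶜ := by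
    intro z hz
    by_cases hzS : z ∈ μ.support
    · left
      obtain ⟨y, hy, hzy⟩ := mem_iUnion₂.1 (hcov ⟨hz, hzS⟩)
      exact mem_iUnion.2 ⟨⟨y, hy⟩, hzy⟩
    · exact Or.inr hzS
  calc ∫⁻ y in closedBall x (σ * r), ‖f y - a‖ₑ ∂μ
      ≤ ∫⁻ y in (⋃ y : t, closedBall (y : E) (c * r)) ∪ μ.supportᶜ, ‖f y - a‖ₑ ∂μ :=
        lintegral_mono_set hsub
    _ ≤ (∫⁻ y in ⋃ y : t, closedBall (y : E) (c * r), ‖f y - a‖ₑ ∂μ) +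
          ∫⁻ y in μ.supportᶜ, ‖f y - a‖ₑ ∂μ := lintegral_union_le _ _ _
    _ = ∫⁻ y in ⋃ y : t, closedBall (y : E) (c * r), ‖f y - a‖ₑ ∂μ := by
        rw [setLIntegral_measure_zero _ _ Measure.measure_compl_support, add_zero]
    _ ≤ ∑' y : t, ∫⁻ y in closedBall (y : E) (c * r), ‖f y - a‖ₑ ∂μ := lintegral_iUnion_le _ _
    _ ≤ ∑' _ : t, ENNReal.ofReal (C₁ + C₂ + C₃) * μ (closedBall x (ρ * r)) :=
        ENNReal.tsum_le_tsum fun y => hball y y.2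
    _ = t.card * (ENNReal.ofReal (C₁ + C₂ + C₃) * μ (closedBall x (ρ * r))) := by
        simp [tsum_fintype]
    _ ≤ K * (ENNReal.ofReal (C₁ + C₂ + C₃) * μ (closedBall x (ρ * r))) := by
        gcongr
    _ = _ := by rw [ENNReal.ofReal_mul (by positivity), ENNReal.ofReal_natCast, mul_assoc]

end BallGrowth

end BallOscillation
section BallSelection

variable {E : Type*} [NormedAddCommGroup E] [NormedSpace ℝ E] [FiniteDimensional ℝ E]
  [MeasurableSpace E] [BorelSpace E]

/-- A set on which the measure of balls drops quickly from scale to scale has small measure. -/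
lemma measure_le_of_forall_lt_mass {μ : Measure E} [IsLocallyFiniteMeasure μ] {κ β' : ℝ}
    (hκ : 0 < κ) {N : ℕ}
    (hN : ∀ (x : E) (R : ℝ), 0 < R → ∀ A ⊆ closedBall x R,
      ∃ t : Finset E, (∀ y ∈ t, y ∈ A) ∧ t.card ≤ N ∧ A ⊆ ⋃ y ∈ t, closedBall y (κ * R))
    (hβ' : 0 < β') (hNβ : 2 * (N : ℝ) ≤ β') (hκ1 : κ ≤ 1) {s : ℝ} (hs : 0 < s) (m : ℕ) :
    ∀ (i : ℕ) (A : Set E) (y : E) (M : ℝ), A ⊆ closedBall y (κ ^ i * s) →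
      (∀ z ∈ A, ∀ j ≥ i, β' * ballMass μ z (κ ^ (j + 1) * s) ≤ ballMass μ z (κ ^ j * s)) →
      (∀ z ∈ A, ballMass μ z (κ ^ i * s) ≤ M) →
      μ A ≤ ENNReal.ofReal (2⁻¹ ^ m * (N * M)) := by
  induction m with
  | zero =>
    intro i A y M hA _ hM
    obtain ⟨t, htA, htN, hcov⟩ := hN y _ (by positivity) A hA
    refine (measure_mono hcov).trans ((measure_biUnion_finset_le _ _).trans ?_)
    rcases A.eq_empty_or_nonempty with rfl | ⟨w, hw⟩
    · have : t = ∅ := Finset.eq_empty_of_forall_notMem fun z hz => htA z hz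
      simp [this]
    have hM0 : 0 ≤ M := (ballMass_nonneg _ _).trans (hM w hw)
    have h1 : ∀ z ∈ t, μ (closedBall z (κ * (κ ^ i * s))) ≤ ENNReal.ofReal M := by
      intro z hz
      rw [← ofReal_ballMass]
      refine ENNReal.ofReal_le_ofReal ((ballMass_mono z ?_).trans (hM z (htA z hz)))
      exact mul_le_of_le_one_left (by positivity) hκ1
    refine (Finset.sum_le_card_nsmul _ _ _ h1).trans ?_
    rw [pow_zero, one_mul, ENNReal.ofReal_mul (by positivity), ENNReal.ofReal_natCast, nsmul_eq_mul]
    gcongr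
  | succ m ih =>
    intro i A y M hA hd hM
    obtain ⟨t, htA, htN, hcov⟩ := hN y _ (by positivity) A hA
    rcases A.eq_empty_or_nonempty with rfl | ⟨w, hw⟩
    · simp
    have hM0 : 0 ≤ M := (ballMass_nonneg _ _).trans (hM w hw)
    have h1 : ∀ z ∈ t, μ (A ∩ closedBall z (κ * (κ ^ i * s))) ≤
        ENNReal.ofReal (2⁻¹ ^ m * (N * (M / β'))) := by
      intro z hz
      refine ih (i + 1) _ z _ ?_ (fun v hv j hj => hd v hv.1 j (by omega)) fun v hv => ?_
      · rw [pow_succ', mul_assoc]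
        exact inter_subset_right
      · rw [le_div_iff₀ hβ', mul_comm]
        exact (hd v hv.1 i le_rfl).trans (hM v hv.1)
    have h2 : A ⊆ ⋃ z ∈ t, A ∩ closedBall z (κ * (κ ^ i * s)) := by
      intro v hv
      obtain ⟨z, hz, hvz⟩ := mem_iUnion₂.1 (hcov hv)
      exact mem_iUnion₂.2 ⟨z, hz, hv, hvz⟩
    refine (measure_mono h2).trans ((measure_biUnion_finset_le _ _).trans ?_)
    refine (Finset.sum_le_card_nsmul _ _ _ h1).trans ?_
    calc t.card • ENNReal.ofReal (2⁻¹ ^ m * (N * (M / β')))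
        ≤ ENNReal.ofReal (N * (2⁻¹ ^ m * (N * (M / β')))) := by
          rw [nsmul_eq_mul, ENNReal.ofReal_mul (Nat.cast_nonneg N), ENNReal.ofReal_natCast]
          gcongr
      _ ≤ _ := by
          refine ENNReal.ofReal_le_ofReal ?_
          have h3 : (N : ℝ) / β' ≤ 2⁻¹ := by
            rw [div_le_iff₀ hβ']
            linarith
          calc (N : ℝ) * (2⁻¹ ^ m * (N * (M / β'))) = (N / β') * (2⁻¹ ^ m * (N * M)) := by ring
            _ ≤ 2⁻¹ * (2⁻¹ ^ m * (N * M)) := by gcongr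
            _ = _ := by ring

/-- For a large doubling constant, almost every point is the center of arbitrarily small doubling
balls. -/
lemma exists_ae_frequently_doubling (E : Type*) [NormedAddCommGroup E] [NormedSpace ℝ E]
    [FiniteDimensional ℝ E] [MeasurableSpace E] [BorelSpace E] {κ : ℝ} (hκ : 0 < κ) (hκ1 : κ ≤ 1) :
    ∃ b : ℝ, ∀ β' ≥ b, ∀ (μ : Measure E) [IsLocallyFiniteMeasure μ], ∀ s > 0, ∀ᵐ y ∂μ,
      ∀ i : ℕ, ∃ j ≥ i, ballMass μ y (κ ^ j * s) ≤ β' * ballMass μ y (κ ^ (j + 1) * s) := by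
  obtain ⟨N, hN⟩ := exists_finset_cover_closedBall E hκ
  refine ⟨2 * N + 1, fun β' hβ' μ _ s hs => ?_⟩
  have hN0 : (0 : ℝ) ≤ N := N.cast_nonneg
  rw [ae_all_iff]
  intro i
  rw [ae_iff]
  refine measure_null_of_locally_null _ fun y _ => ?_
  refine ⟨_, inter_mem self_mem_nhdsWithin
    (mem_nhdsWithin_of_mem_nhds (closedBall_mem_nhds y (show 0 < κ ^ i * s by positivity))), ?_⟩
  set A := {a | ¬∃ j ≥ i, ballMass μ a (κ ^ j * s) ≤ β' * ballMass μ a (κ ^ (j + 1) * s)} ∩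
    closedBall y (κ ^ i * s)
  have h1 : ∀ m : ℕ, μ A ≤ ENNReal.ofReal (2⁻¹ ^ m * (N * ballMass μ y (2 * (κ ^ i * s)))) := by
    intro m
    refine measure_le_of_forall_lt_mass (β' := β') hκ hN (by linarith) (by linarith) hκ1 hs
      m i A y _ inter_subset_right (fun z hz j hj => ?_) fun z hz => ?_
    · by_contra! hc
      exact hz.1 ⟨j, hj, hc.le⟩
    · refine ballMass_le_of_subset (closedBall_subset_closedBall' ?_)
      have := mem_closedBall.1 hz.2
      linarith
  have h2 : Tendsto (fun m : ℕ => ENNReal.ofReal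
      (2⁻¹ ^ m * (N * ballMass μ y (2 * (κ ^ i * s))))) atTop (𝓝 0) := by
    rw [← ENNReal.ofReal_zero]
    refine ENNReal.tendsto_ofReal ?_
    rw [← zero_mul (N * ballMass μ y (2 * (κ ^ i * s)))]
    exact (tendsto_pow_atTop_nhds_zero_of_lt_one (by norm_num) (by norm_num)).mul_const _
  exact le_antisymm (ge_of_tendsto' h2 h1) bot_le

/-- Lebesgue differentiation along balls shrinking geometrically. -/
lemma ae_tendsto_ballAvg {μ : Measure E} [IsLocallyFiniteMeasure μ] {f : E → ℝ}
    (hf : LocallyIntegrable f μ) {κ s : ℝ} (hκ : 0 < κ) (hκ1 : κ < 1) (hs : 0 < s) :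
    ∀ᵐ y ∂μ, Tendsto (fun j : ℕ => ballAvg μ f y (κ ^ j * s)) atTop (𝓝 (f y)) := by
  have : ProperSpace E := FiniteDimensional.proper_real E
  filter_upwards [(Besicovitch.vitaliFamily μ).ae_tendsto_average hf] with y hy
  have h1 : Tendsto (fun j : ℕ => κ ^ j * s) atTop (𝓝[>] 0) := by
    refine tendsto_nhdsWithin_iff.2 ⟨?_, Eventually.of_forall fun j => by
      simp only [mem_Ioi]; positivity⟩
    rw [← zero_mul s]
    exact (tendsto_pow_atTop_nhds_zero_of_lt_one hκ.le hκ1).mul_const _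
  have h2 := hy.comp ((Besicovitch.tendsto_filterAt μ y).comp h1)
  refine h2.congr fun j => ?_
  simp [ballAvg, ballMass, setAverage_eq]

namespace BallGrowth

variable {μ : Measure E} [IsLocallyFiniteMeasure μ] {n : ℕ} {ρ β γ C₀ : ℝ}

/-- Almost every point where `f` is far from its doubling average is the center of a doubling ball
whose doubling average is at a prescribed distance from the original one. -/
lemma exists_doubling_selection (h : BallGrowth μ n ρ β γ C₀) {η : ℝ} (hη : η ≤ ρ)
    (hη1 : 1 ≤ η) (r₀ : ℝ) {τ : ℝ} (hτ : 0 < τ) (hτ1 : τ ≤ 1) :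
    ∃ β' M : ℝ, 0 < β' ∧ 0 ≤ M ∧ ∀ f, BallOsc μ n η ρ β r₀ f → ∀ x ∈ μ.support, ∀ r, 0 < r →
      ∀ B ≥ M, ∀ᵐ y ∂μ, y ∈ closedBall x r → B + M < |f y - doublingAvg μ ρ β f x r| →
        ∃ t, 0 < t ∧ t ≤ τ * r ∧
          μ (closedBall y (ρ * t)) ≤ ENNReal.ofReal β' * μ (closedBall y t) ∧
          |doublingAvg μ ρ β f y t - doublingAvg μ ρ β f x r| ≤ B + M ∧
          ENNReal.ofReal (B - M) * μ (closedBall y t) ≤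
            ∫⁻ z in closedBall y t, ‖f z - doublingAvg μ ρ β f x r‖ₑ ∂μ := by
  have hρ := h.ρ_pos
  have hρ1 := h.one_lt_ρ
  have hβ1 := h.one_lt_β
  obtain ⟨b, hb⟩ := exists_ae_frequently_doubling E (inv_pos.2 hρ) (inv_le_one_of_one_le₀ hρ1.le)
  set β' := max b β with hβ'
  have hβ'0 : 0 < β' := by
    have := le_max_right b β
    linarith
  obtain ⟨C1, hC1, H1⟩ := h.doublingAvg_sub_le_of_le_mul hη r₀ (inv_pos.2 hτ)
  obtain ⟨C1', hC1', H1'⟩ := h.doublingAvg_sub_le_of_dist_le hη r₀ zero_le_one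
  obtain ⟨C2, hC2, H2⟩ := h.doublingAvg_sub_le_of_le_mul hη r₀ hρ
  obtain ⟨C3, hC3, H3⟩ := h.doublingAvg_sub_le_of_decay hη r₀
    (show 0 ≤ β * C₀ from mul_nonneg (by linarith) h.C₀_pos.le)
  obtain ⟨C4, hC4, H4⟩ := h.lintegral_sub_doublingAvg_le hη hη1 r₀ one_pos hρ1
  set C5 := C4 * β' with hC5
  have hC50 : 0 ≤ C5 := by positivity
  refine ⟨β', C1 + C1' + 2 * C2 + C3 + C5 + 1, hβ'0, by positivity, ?_⟩
  intro f hf x hx r hr B hB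
  set a := doublingAvg μ ρ β f x r
  set s := τ * r with hs
  have hs0 : 0 < s := by positivity
  have hsupp : ∀ᵐ y ∂μ, y ∈ μ.support := by
    rw [ae_iff]
    exact Measure.measure_compl_support
  filter_upwards [hsupp, hb β' (le_max_left _ _) μ s hs0,
    ae_tendsto_ballAvg hf.locInt (inv_pos.2 hρ) (inv_lt_one_of_one_lt₀ hρ1) hs0]
    with y hy hdoub hleb hyx hfar
  set S : ℕ → ℝ := fun j => ρ⁻¹ ^ j * s with hS
  have hSpos : ∀ j, 0 < S j := fun j => by positivity
  have hSs : ∀ j k, ρ ^ k * S (j + k) = S j := fun j k => by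
    simp only [hS, pow_add, inv_pow]
    field_simp
  have hSs1 : ∀ j, ρ * S (j + 1) = S j := fun j => by simpa using hSs j 1
  set c : ℕ → ℝ := fun j => doublingAvg μ ρ β f y (S j) with hc
  have hstart : |c 0 - a| ≤ C1 + C1' := by
    have e1 := H1 f hf y hy s r hs0 (by nlinarith) (by rw [hs]; field_simp; rfl)
    have e2 := H1' f hf y hy x hx r hr (by simpa using hyx)
    have : c 0 = doublingAvg μ ρ β f y s := by simp [hc, hS]
    rw [this]
    exact (abs_sub_le _ _ _).trans (add_le_add e1 e2)
  have hstep : ∀ j, |c (j + 1) - c j| ≤ C2 := fun j =>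
    H2 f hf y hy (S (j + 1)) (S j) (hSpos _)
      ((le_mul_of_one_le_left (hSpos _).le hρ1.le).trans_eq (hSs1 j)) (hSs1 j).ge
  have hosc : ∀ j, ballMass μ y (S j) ≤ β' * ballMass μ y (S (j + 1)) →
      ∫⁻ z in closedBall y (S (j + 1)), ‖f z - c (j + 1)‖ₑ ∂μ ≤
        ENNReal.ofReal (C5 * ballMass μ y (S (j + 1))) := by
    intro j hj
    have e1 := H4 f hf y hy (S (j + 1)) (hSpos _)
    rw [one_mul, hSs1, ← ofReal_ballMass, ← ENNReal.ofReal_mul hC4] at e1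
    refine e1.trans (ENNReal.ofReal_le_ofReal ?_)
    rw [hC5, mul_assoc]
    exact mul_le_mul_of_nonneg_left hj hC4
  have hfint : ∀ (j : ℕ) (q : ℝ), ∫⁻ z in closedBall y (S j), ‖f z - q‖ₑ ∂μ =
      ENNReal.ofReal (∫ z in closedBall y (S j), |f z - q| ∂μ) := by
    intro j q
    rw [ofReal_integral_eq_lintegral_ofReal (hf.integrableOn_sub q y _)
      (Eventually.of_forall fun _ => abs_nonneg _)]
    refine lintegral_congr fun z => ?_
    rw [Real.enorm_eq_ofReal_abs]
  have hmpos : ∀ j, 0 < ballMass μ y (S j) := fun j => ballMass_pos hy (hSpos j)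
  have hosc' : ∀ j, ballMass μ y (S j) ≤ β' * ballMass μ y (S (j + 1)) →
      ∫ z in closedBall y (S (j + 1)), |f z - c (j + 1)| ∂μ ≤
        C5 * ballMass μ y (S (j + 1)) := by
    intro j hj
    have e1 := hosc j hj
    rw [hfint] at e1
    exact (ENNReal.ofReal_le_ofReal_iff (mul_nonneg hC50 (hmpos _).le)).1 e1
  have havg : ∀ j, ballMass μ y (S j) ≤ β' * ballMass μ y (S (j + 1)) →
      |ballAvg μ f y (S (j + 1)) - c (j + 1)| ≤ C5 := by
    intro j hj
    have e1 := abs_integral_ball_le_of_abs_le (fun z => f z - c (j + 1)) y (S (j + 1))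
      (hosc' j hj) (hmpos _)
    refine le_trans (le_of_eq ?_) e1
    congr 1
    rw [ballAvg, ballAvg, integral_sub (hf.integrableOn _ _)
      (integrableOn_const (measure_closedBall_ne_top _ _)), setIntegral_const, mul_sub]
    congr 1
    rw [smul_eq_mul, ← mul_assoc]
    change _ = (ballMass μ y (S (j + 1)))⁻¹ * ballMass μ y (S (j + 1)) * _
    rw [inv_mul_cancel₀ (hmpos _).ne', one_mul]
  have hexit : ∃ i, B < |c i - a| := by
    obtain ⟨k, hk⟩ := (Metric.tendsto_atTop.1 hleb) 1 one_pos
    obtain ⟨j, hjk, hj⟩ := hdoub k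
    refine ⟨j + 1, ?_⟩
    have e1 := hk (j + 1) (by omega)
    rw [Real.dist_eq] at e1
    have e2 := havg j hj
    have e3 := abs_sub_le (f y) (ballAvg μ f y (S (j + 1))) a
    have e4 := abs_sub_le (ballAvg μ f y (S (j + 1))) (c (j + 1)) a
    rw [abs_sub_comm (f y) (ballAvg μ f y _)] at e3
    change |ballAvg μ f y (S (j + 1)) - f y| < 1 at e1
    linarith
  classical
  obtain ⟨i, hi, hmin⟩ : ∃ i, B < |c i - a| ∧ ∀ k < i, |c k - a| ≤ B :=
    ⟨Nat.find hexit, Nat.find_spec hexit, fun k hk => not_lt.1 (Nat.find_min hexit hk)⟩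
  have hi_le : |c i - a| ≤ B + C2 := by
    cases i with
    | zero => linarith
    | succ i =>
      have e1 := hmin i (by omega)
      have e2 := hstep i
      have e3 := abs_sub_le (c (i + 1)) (c i) a
      linarith
  obtain ⟨j, ⟨hij, hj⟩, hjmin⟩ : ∃ j, (i ≤ j ∧ ballMass μ y (S j) ≤ β' * ballMass μ y (S (j + 1)))
      ∧ ∀ k < j, ¬ (i ≤ k ∧ ballMass μ y (S k) ≤ β' * ballMass μ y (S (k + 1))) :=
    ⟨Nat.find (hdoub i), Nat.find_spec (hdoub i), fun k hk => Nat.find_min (hdoub i) hk⟩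
  have hji : |c j - c i| ≤ C3 := by
    obtain ⟨m, rfl⟩ := Nat.exists_eq_add_of_le hij
    have e1 : DensityDecay μ n γ y (S (i + m)) (ρ ^ m * S (i + m)) (β * C₀) := by
      refine h.decay_of_geometric hy (hSpos _) fun k hk => ?_
      have e2 := hjmin (i + (m - (k + 1))) (by omega)
      simp only [not_and, not_le] at e2
      have e3 := e2 (by omega)
      have e4 : i + m = i + (m - (k + 1)) + (k + 1) := by omega
      have e5 : i + m = i + (m - (k + 1)) + 1 + k := by omega
      have e6 : ρ ^ k * S (i + m) = S (i + (m - (k + 1)) + 1) := by rw [e5, hSs]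
      have e7 : ρ ^ (k + 1) * S (i + m) = S (i + (m - (k + 1))) := by rw [e4, hSs]
      rw [e6, e7]
      refine le_trans ?_ e3.le
      exact mul_le_mul_of_nonneg_right (le_max_right _ _) (hmpos _).le
    rw [hSs] at e1
    refine H3 f hf y hy _ _ (hSpos _) ?_ e1
    rw [← hSs i m]
    exact le_mul_of_one_le_left (hSpos _).le (one_le_pow₀ hρ1.le)
  have e1 := hstep j
  have e2 := abs_sub_le (c (j + 1)) (c j) a
  have e3 := abs_sub_le (c j) (c i) a
  have e4 := abs_sub_le (c i) (c j) a
  have e5 := abs_sub_le (c j) (c (j + 1)) a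
  rw [abs_sub_comm (c i) (c j)] at e4
  rw [abs_sub_comm (c j) (c (j + 1))] at e5
  refine ⟨S (j + 1), hSpos _, ?_, ?_, ?_, ?_⟩
  · exact mul_le_of_le_one_left hs0.le (pow_le_one₀ (by positivity) (inv_le_one_of_one_le₀ hρ1.le))
  · rw [hSs1, ← ofReal_ballMass, ← ofReal_ballMass, ← ENNReal.ofReal_mul hβ'0.le]
    exact ENNReal.ofReal_le_ofReal hj
  · change |c (j + 1) - a| ≤ _
    linarith
  · rw [hfint, ← ofReal_ballMass, ← ENNReal.ofReal_mul (by linarith)]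
    refine ENNReal.ofReal_le_ofReal ?_
    have e6 := hf.abs_sub_mul_mass_le (c (j + 1)) a y (S (j + 1))
    have e7 := hosc' j hj
    have e8 : B - C2 - C3 ≤ |c (j + 1) - a| := by linarith
    have e9 := mul_le_mul_of_nonneg_right e8 (hmpos (j + 1)).le
    have e10 : (B - (C1 + C1' + 2 * C2 + C3 + C5 + 1)) * ballMass μ y (S (j + 1)) ≤
        (B - C2 - C3 - C5) * ballMass μ y (S (j + 1)) :=
      mul_le_mul_of_nonneg_right (by linarith) (hmpos _).le
    nlinarith

end BallGrowth

end BallSelection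

section BallGoodLambda

variable {E : Type*} [NormedAddCommGroup E] [NormedSpace ℝ E] [FiniteDimensional ℝ E]
  [MeasurableSpace E] [BorelSpace E]

/-- A mass bound on balls centered at each point of a set, summed up with the Besicovitch covering
theorem. -/
lemma exists_measure_le_lintegral_of_balls (E : Type*) [NormedAddCommGroup E] [NormedSpace ℝ E]
    [FiniteDimensional ℝ E] [MeasurableSpace E] [BorelSpace E] :
    ∃ N : ℕ, ∀ (μ : Measure E) (A D : Set E) (t : E → ℝ) (R : ℝ) (g : E → ℝ≥0∞),
      (∀ y ∈ A, 0 < t y) → (∀ y ∈ A, t y ≤ R) → (∀ y ∈ A, closedBall y (t y) ⊆ D) →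
      (∀ y ∈ A, μ (A ∩ closedBall y (t y)) ≤ ∫⁻ z in closedBall y (t y), g z ∂μ) →
      μ A ≤ N * ∫⁻ z in D, g z ∂μ := by
  have : ProperSpace E := FiniteDimensional.proper_real E
  obtain ⟨N, τ, hτ, hN⟩ := HasBesicovitchCovering.no_satelliteConfig (α := E)
  refine ⟨N, fun μ A D t R g ht htR hD hμ => ?_⟩
  let p : Besicovitch.BallPackage A E :=
    { c := fun y => y
      r := fun y => t y
      rpos := fun y => ht y y.2
      r_bound := R
      r_le := fun y => htR y y.2 }
  obtain ⟨u, hu, hcov⟩ := Besicovitch.exist_disjoint_covering_families hτ hN p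
  have hcount : ∀ i, (u i).Countable := fun i => by
    refine (hu i).countable_of_nonempty_interior fun j _ => ?_
    exact (nonempty_ball.2 (p.rpos j)).mono ball_subset_interior_closedBall
  have hA : A ⊆ ⋃ i, ⋃ j ∈ u i, A ∩ closedBall (p.c j) (p.r j) := by
    intro y hy
    obtain ⟨i, hi⟩ := mem_iUnion.1 (hcov ⟨⟨y, hy⟩, rfl⟩)
    obtain ⟨j, hj, hyj⟩ := mem_iUnion₂.1 hi
    exact mem_iUnion.2 ⟨i, mem_iUnion₂.2 ⟨j, hj, hy, ball_subset_closedBall hyj⟩⟩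
  have hfam : ∀ i, μ (⋃ j ∈ u i, A ∩ closedBall (p.c j) (p.r j)) ≤ ∫⁻ z in D, g z ∂μ := by
    intro i
    calc μ (⋃ j ∈ u i, A ∩ closedBall (p.c j) (p.r j))
        ≤ ∑' j : u i, μ (A ∩ closedBall (p.c j) (p.r j)) := measure_biUnion_le μ (hcount i) _
      _ ≤ ∑' j : u i, ∫⁻ z in closedBall (p.c j) (p.r j), g z ∂μ :=
          ENNReal.tsum_le_tsum fun j => hμ _ j.1.2
      _ = ∫⁻ z in ⋃ j ∈ u i, closedBall (p.c j) (p.r j), g z ∂μ :=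
          (lintegral_biUnion (hcount i) (fun _ _ => measurableSet_closedBall) (hu i) g).symm
      _ ≤ _ := lintegral_mono_set (iUnion₂_subset fun j _ => hD _ j.2)
  calc μ A ≤ ∑ i, μ (⋃ j ∈ u i, A ∩ closedBall (p.c j) (p.r j)) :=
        (measure_mono hA).trans (measure_iUnion_fintype_le μ _)
    _ ≤ ∑ _i : Fin N, ∫⁻ z in D, g z ∂μ := Finset.sum_le_sum fun i _ => hfam i
    _ = _ := by simp

namespace BallGrowth

variable {μ : Measure E} [IsLocallyFiniteMeasure μ] {n : ℕ} {ρ β γ C₀ : ℝ}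

/-- Geometric decay of the distribution function of `f` around its doubling average. -/
theorem measure_lt_abs_sub_doublingAvg_le (h : BallGrowth μ n ρ β γ C₀) {η : ℝ} (hη : η ≤ ρ)
    (hη1 : 1 ≤ η) (r₀ : ℝ) : ∃ b : ℝ, 0 < b ∧ ∀ f, BallOsc μ n η ρ β r₀ f →
      ∀ (k : ℕ), ∀ x ∈ μ.support, ∀ r, 0 < r →
        μ {y ∈ closedBall x r | k * b < |f y - doublingAvg μ ρ β f x r|} ≤
          ENNReal.ofReal (2⁻¹ ^ k) * μ (closedBall x (ρ * r)) := by
  have hρ1 := h.one_lt_ρ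
  obtain ⟨τ, hτ, hτ1, hτρ⟩ : ∃ τ : ℝ, 0 < τ ∧ τ ≤ 1 ∧ 1 + τ < ρ :=
    ⟨min 1 ((ρ - 1) / 2), lt_min one_pos (by linarith), min_le_left _ _, by
      have := min_le_right 1 ((ρ - 1) / 2)
      linarith⟩
  obtain ⟨β', M, hβ', hM, hsel⟩ := h.exists_doubling_selection hη hη1 r₀ hτ hτ1
  obtain ⟨C, hC, hosc⟩ := h.lintegral_sub_doublingAvg_le hη hη1 r₀ (by linarith : 0 < 1 + τ) hτρ
  obtain ⟨N, hN⟩ := exists_measure_le_lintegral_of_balls E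
  set T : ℝ := 2 * N * β' * C + 1 with hT
  have hT0 : 0 < T := by positivity
  have hb0 : 0 < M + T + M := by linarith
  refine ⟨M + T + M, hb0, fun f hf k => ?_⟩
  set b : ℝ := M + T + M with hb
  induction k with
  | zero =>
    intro x _ r hr
    rw [pow_zero, ENNReal.ofReal_one, one_mul]
    exact measure_mono ((sep_subset _ _).trans
      (closedBall_subset_closedBall (le_mul_of_one_le_left hr.le hρ1.le)))
  | succ k ih =>
    intro x hx r hr
    set a := doublingAvg μ ρ β f x r with ha
    have hs := hsel f hf x hx r hr (M + T) (by linarith)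
    set A := {y ∈ closedBall x r | (k + 1 : ℕ) * b < |f y - a|} with hA
    set G := {y | y ∈ μ.support ∧ ∃ t, 0 < t ∧ t ≤ τ * r ∧
          μ (closedBall y (ρ * t)) ≤ ENNReal.ofReal β' * μ (closedBall y t) ∧
          |doublingAvg μ ρ β f y t - a| ≤ M + T + M ∧
          ENNReal.ofReal (M + T - M) * μ (closedBall y t) ≤
            ∫⁻ z in closedBall y t, ‖f z - a‖ₑ ∂μ} with hG
    have hsupp : ∀ᵐ y ∂μ, y ∈ μ.support := by
      rw [ae_iff]
      exact Measure.measure_compl_support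
    have hAG : μ A ≤ μ (A ∩ G) := by
      refine measure_mono_ae ?_
      filter_upwards [hs, hsupp] with y hy hys hyA
      refine ⟨hyA, hys, hy hyA.1 ?_⟩
      refine lt_of_le_of_lt ?_ hyA.2
      have : (0 : ℝ) ≤ k := k.cast_nonneg
      push_cast
      nlinarith
    have hch : ∀ y : E, ∃ t : ℝ, y ∈ G → 0 < t ∧ t ≤ τ * r ∧
          μ (closedBall y (ρ * t)) ≤ ENNReal.ofReal β' * μ (closedBall y t) ∧
          |doublingAvg μ ρ β f y t - a| ≤ b ∧
          ENNReal.ofReal T * μ (closedBall y t) ≤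
            ∫⁻ z in closedBall y t, ‖f z - a‖ₑ ∂μ := by
      intro y
      by_cases hy : y ∈ G
      · obtain ⟨t, ht⟩ := hy.2
        rw [add_sub_cancel_left] at ht
        exact ⟨t, fun _ => ht⟩
      · exact ⟨0, fun h => absurd h hy⟩
    choose t ht using hch
    set K : ℝ := 2⁻¹ ^ k * (β' / T) with hK
    have hK0 : 0 ≤ K := by positivity
    have h1 := hN μ (A ∩ G) (closedBall x ((1 + τ) * r)) t (τ * r)
      (fun z => ENNReal.ofReal K * ‖f z - a‖ₑ) (fun y hy => (ht y hy.2).1)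
      (fun y hy => (ht y hy.2).2.1) (fun y hy => ?_) (fun y hy => ?_)
    · refine hAG.trans (h1.trans ?_)
      rw [lintegral_const_mul' _ _ ENNReal.ofReal_ne_top]
      calc (N : ℝ≥0∞) * (ENNReal.ofReal K * ∫⁻ z in closedBall x ((1 + τ) * r), ‖f z - a‖ₑ ∂μ)
          ≤ N * (ENNReal.ofReal K * (ENNReal.ofReal C * μ (closedBall x (ρ * r)))) := by
            gcongr
            exact hosc f hf x hx r hr
        _ = ENNReal.ofReal (N * (K * C)) * μ (closedBall x (ρ * r)) := by
            rw [ENNReal.ofReal_mul (Nat.cast_nonneg N), ENNReal.ofReal_mul hK0,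
              ENNReal.ofReal_natCast]
            ring
        _ ≤ _ := by
            gcongr
            rw [pow_succ, hK]
            have : N * (β' / T * C) ≤ 2⁻¹ := by
              rw [div_mul_eq_mul_div, ← mul_div_assoc, div_le_iff₀ hT0]
              rw [hT]
              nlinarith
            calc (N : ℝ) * (2⁻¹ ^ k * (β' / T) * C) = 2⁻¹ ^ k * (N * (β' / T * C)) := by ring
              _ ≤ _ := by gcongr
    · refine closedBall_subset_closedBall' ?_
      have h2 := (ht y hy.2).2.1
      have h3 := mem_closedBall.1 hy.1.1
      linarith
    · obtain ⟨ht0, -, htd, hta, htT⟩ := ht y hy.2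
      have h2 := ih y hy.2.1 (t y) ht0
      have h3 : (A ∩ G) ∩ closedBall y (t y) ⊆
          {z ∈ closedBall y (t y) | k * b < |f z - doublingAvg μ ρ β f y (t y)|} := by
        intro z hz
        refine ⟨hz.2, ?_⟩
        have h4 := hz.1.1.2
        have h5 := abs_sub_le (f z) (doublingAvg μ ρ β f y (t y)) a
        push_cast at h4
        linarith
      have h6 : μ (closedBall y (t y)) ≤
          ENNReal.ofReal T⁻¹ * ∫⁻ z in closedBall y (t y), ‖f z - a‖ₑ ∂μ := by
        rw [ENNReal.ofReal_inv_of_pos hT0, mul_comm, ← div_eq_mul_inv,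
          ENNReal.le_div_iff_mul_le (Or.inl (by simpa using hT0)) (Or.inl ENNReal.ofReal_ne_top),
          mul_comm]
        exact htT
      refine (measure_mono h3).trans (h2.trans ?_)
      rw [lintegral_const_mul' _ _ ENNReal.ofReal_ne_top]
      calc ENNReal.ofReal (2⁻¹ ^ k) * μ (closedBall y (ρ * t y))
          ≤ ENNReal.ofReal (2⁻¹ ^ k) * (ENNReal.ofReal β' * (ENNReal.ofReal T⁻¹ *
              ∫⁻ z in closedBall y (t y), ‖f z - a‖ₑ ∂μ)) := by
            gcongr
            exact htd.trans (by gcongr)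
        _ = _ := by
            rw [hK, div_eq_mul_inv, ENNReal.ofReal_mul (by positivity),
              ENNReal.ofReal_mul hβ'.le]
            ring

end BallGrowth

end BallGoodLambda

section BallExponential

variable {E : Type*} [NormedAddCommGroup E] [NormedSpace ℝ E] [FiniteDimensional ℝ E]
  [MeasurableSpace E] [BorelSpace E]

namespace BallGrowth

variable {μ : Measure E} [IsLocallyFiniteMeasure μ] {n : ℕ} {ρ β γ C₀ : ℝ}

/-- Exponential decay of the distribution function of `f` around its doubling average. -/
lemma measure_lt_abs_sub_doublingAvg_le_exp (h : BallGrowth μ n ρ β γ C₀) {η : ℝ} (hη : η ≤ ρ)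
    (hη1 : 1 ≤ η) (r₀ : ℝ) : ∃ c : ℝ, 0 < c ∧ ∀ f, BallOsc μ n η ρ β r₀ f →
      ∀ x ∈ μ.support, ∀ r, 0 < r → ∀ lam : ℝ,
        μ {y ∈ closedBall x r | lam < |f y - doublingAvg μ ρ β f x r|} ≤
          ENNReal.ofReal (2 * Real.exp (-(c * lam))) * μ (closedBall x (ρ * r)) := by
  obtain ⟨b, hb, H⟩ := h.measure_lt_abs_sub_doublingAvg_le hη hη1 r₀
  have hlog := Real.log_pos one_lt_two
  have hc : 0 < Real.log 2 / b := by positivity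
  refine ⟨Real.log 2 / b, hc, fun f hf x hx r hr lam => ?_⟩
  rcases le_or_gt 0 lam with h0 | h0
  · refine le_trans (measure_mono ?_) ((H f hf ⌊lam / b⌋₊ x hx r hr).trans ?_)
    · intro y hy
      refine ⟨hy.1, lt_of_le_of_lt ?_ hy.2⟩
      rw [← le_div_iff₀ hb]
      exact Nat.floor_le (by positivity)
    · gcongr
      have hexp : Real.exp (-(Real.log 2 / b * lam)) = 2 ^ (-(lam / b)) := by
        rw [Real.rpow_def_of_pos two_pos]
        congr 1
        ring
      rw [hexp, ← Real.rpow_natCast, Real.inv_rpow two_pos.le, ← Real.rpow_neg two_pos.le]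
      calc (2 : ℝ) ^ (-(⌊lam / b⌋₊ : ℝ)) ≤ 2 ^ (1 + -(lam / b)) := by
            refine Real.rpow_le_rpow_of_exponent_le one_le_two ?_
            have := Nat.lt_floor_add_one (lam / b)
            linarith
        _ = _ := by rw [Real.rpow_add two_pos, Real.rpow_one]
  · refine (measure_mono ((sep_subset _ _).trans (closedBall_subset_closedBall
      (le_mul_of_one_le_left hr.le h.one_lt_ρ.le)))).trans (le_mul_of_one_le_left bot_le ?_)
    rw [ENNReal.one_le_ofReal]
    have := Real.one_le_exp (x := -(Real.log 2 / b * lam)) (by nlinarith)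
    linarith

/-- If the mean value over a ball is far from the doubling average, the ball has little mass. -/
lemma mass_le_exp_avg_sub_doublingAvg (h : BallGrowth μ n ρ β γ C₀) {η r₀ c : ℝ} (hc : 0 < c)
    {f : E → ℝ} (hf : BallOsc μ n η ρ β r₀ f) {x : E} (hx : x ∈ μ.support) {r : ℝ} (hr : 0 < r)
    (H : ∀ lam : ℝ, μ {y ∈ closedBall x r | lam < |f y - doublingAvg μ ρ β f x r|} ≤
      ENNReal.ofReal (2 * Real.exp (-(c * lam))) * μ (closedBall x (ρ * r))) :
    ballMass μ x r ≤ (4 / c + Real.exp (c / 2)) *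
      Real.exp (-(c / 2 * |ballAvg μ f x r - doublingAvg μ ρ β f x r|)) *
        ballMass μ x (ρ * r) := by
  set a := doublingAvg μ ρ β f x r
  set A := |ballAvg μ f x r - a| with hA
  have hm := ballMass_pos hx hr
  have hmρ := ballMass_pos hx (mul_pos h.ρ_pos hr)
  have hmm := ballMass_mono (μ := μ) x (le_mul_of_one_le_left hr.le h.one_lt_ρ.le)
  rcases lt_or_ge A 1 with hA1 | hA1
  · refine hmm.trans (le_mul_of_one_le_left hmρ.le ?_)
    have h1 : 1 ≤ Real.exp (c / 2) * Real.exp (-(c / 2 * A)) := by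
      rw [← Real.exp_add]
      exact Real.one_le_exp (by nlinarith)
    have h2 : 0 ≤ 4 / c * Real.exp (-(c / 2 * A)) := by positivity
    linarith
  · have hfint := hf.integrableOn_sub a x r
    have h1 : A * ballMass μ x r ≤ ∫ y in closedBall x r, |f y - a| ∂μ := by
      have e1 : ballAvg μ f x r - a = ballAvg μ (fun y => f y - a) x r := by
        rw [ballAvg, ballAvg, integral_sub (hf.integrableOn _ _)
          (integrableOn_const (measure_closedBall_ne_top _ _)), setIntegral_const, mul_sub]
        congr 1
        change a = (ballMass μ x r)⁻¹ * (ballMass μ x r * a)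
        rw [inv_mul_cancel_left₀ hm.ne']
      rw [hA, e1, ← le_div_iff₀ hm]
      refine abs_integral_ball_le_of_abs_le _ x r (le_of_eq ?_) hm
      field_simp
    set e : ℝ := 2 * (Real.exp (-(c * (A / 2))) / c) with he
    have h2 : ENNReal.ofReal (∫ y in closedBall x r, |f y - a| ∂μ) ≤
        ENNReal.ofReal (A / 2 * ballMass μ x r + e * ballMass μ x (ρ * r)) := by
      rw [ofReal_integral_eq_lintegral_ofReal hfint (Eventually.of_forall fun _ => abs_nonneg _),
        lintegral_eq_lintegral_meas_lt _ (Eventually.of_forall fun _ => abs_nonneg _)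
          hfint.aestronglyMeasurable.aemeasurable,
        ← Ioc_union_Ioi_eq_Ioi (show (0 : ℝ) ≤ A / 2 by positivity)]
      refine (lintegral_union_le _ _ _).trans ?_
      rw [ENNReal.ofReal_add (by positivity) (by positivity)]
      refine add_le_add ?_ ?_
      · calc ∫⁻ t in Ioc 0 (A / 2), (μ.restrict (closedBall x r)) {y | t < |f y - a|}
            ≤ ∫⁻ _ in Ioc 0 (A / 2), μ (closedBall x r) := by
              refine lintegral_mono fun t => (measure_mono (subset_univ _)).trans ?_
              rw [Measure.restrict_apply_univ]
          _ = _ := by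
              rw [setLIntegral_const, Real.volume_Ioc, sub_zero, mul_comm,
                ENNReal.ofReal_mul (by positivity), ofReal_ballMass]
      · calc ∫⁻ t in Ioi (A / 2), (μ.restrict (closedBall x r)) {y | t < |f y - a|}
            ≤ ∫⁻ t in Ioi (A / 2), ENNReal.ofReal (2 * Real.exp (-c * t)) *
                μ (closedBall x (ρ * r)) := by
              refine lintegral_mono fun t => ?_
              rw [Measure.restrict_apply' measurableSet_closedBall, inter_comm]
              exact (H t).trans_eq (by rw [neg_mul])
          _ = _ := by
              rw [lintegral_mul_const' _ _ (measure_closedBall_ne_top _ _),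
                ← ofReal_integral_eq_lintegral_ofReal
                  ((integrableOn_exp_mul_Ioi (neg_lt_zero.2 hc) _).const_mul 2)
                  (Eventually.of_forall fun _ => by positivity),
                integral_const_mul, integral_exp_mul_Ioi (neg_lt_zero.2 hc), neg_div_neg_eq,
                neg_mul, ← he, ENNReal.ofReal_mul (p := e) (by positivity), ofReal_ballMass]
    rw [ENNReal.ofReal_le_ofReal_iff (by positivity)] at h2
    have h3 : ballMass μ x r ≤ 2 * e * ballMass μ x (ρ * r) := by nlinarith
    refine h3.trans (mul_le_mul_of_nonneg_right ?_ hmρ.le)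
    have h4 : -(c * (A / 2)) = -(c / 2 * A) := by ring
    have h5 : 2 * e = 4 / c * Real.exp (-(c / 2 * A)) := by
      rw [he, h4]
      ring
    rw [h5]
    gcongr
    exact le_add_of_nonneg_right (Real.exp_pos _).le

/-- The John–Nirenberg inequality for balls, with respect to the mean value over the first doubling
dyadic dilate (if there is none, the ball itself) for small balls, and zero for large balls. -/
theorem john_nirenberg (h : BallGrowth μ n ρ β γ C₀) {η : ℝ} (hη : η ≤ ρ)
    (hη1 : 1 ≤ η) (r₀ : ℝ) : ∃ C : ℝ, 0 < C ∧ ∃ c : ℝ, 0 < c ∧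
      ∀ f, BallOsc μ n η ρ β r₀ f → ∀ x ∈ μ.support, ∀ r, 0 < r → ∀ lam : ℝ, 0 < lam →
        (r ≤ r₀ → μ {y ∈ closedBall x r | lam < |f y -
            ballAvg μ f x (2 ^ sInf {N : ℕ | BallDoubling μ ρ β x (2 ^ N * r)} * r)|} ≤
          ENNReal.ofReal (C * Real.exp (-(c * lam))) * μ (closedBall x (ρ * r))) ∧
        (r₀ < r → μ {y ∈ closedBall x r | lam < |f y|} ≤
          ENNReal.ofReal (C * Real.exp (-(c * lam))) * μ (closedBall x (ρ * r))) := by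
  obtain ⟨c, hc, H⟩ := h.measure_lt_abs_sub_doublingAvg_le_exp hη hη1 r₀
  obtain ⟨C, hC, hdy⟩ := h.doublingAvg_sub_dyadic_le hη r₀
  have hβ := h.one_lt_β
  have hnear : ∀ f, BallOsc μ n η ρ β r₀ f → ∀ x ∈ μ.support, ∀ r, 0 < r → ∀ lam : ℝ, 0 < lam →
      ∀ q D K : ℝ, |doublingAvg μ ρ β f x r - q| ≤ D → 2 * Real.exp (c * D) ≤ K →
        μ {y ∈ closedBall x r | lam < |f y - q|} ≤
          ENNReal.ofReal (K * Real.exp (-(c / 4 * lam))) * μ (closedBall x (ρ * r)) := by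
    intro f hf x hx r hr lam hlam q D K hq hK
    refine le_trans (measure_mono ?_) ((H f hf x hx r hr (lam - D)).trans ?_)
    · intro y hy
      refine ⟨hy.1, ?_⟩
      have h1 := abs_sub_le (f y) (doublingAvg μ ρ β f x r) q
      have h2 := hy.2
      linarith
    · gcongr ENNReal.ofReal ?_ * _
      have h1 : -(c * (lam - D)) = c * D + -(c * lam) := by ring
      rw [h1, Real.exp_add, ← mul_assoc]
      exact mul_le_mul hK (Real.exp_le_exp.2 (by nlinarith)) (Real.exp_pos _).le
        (le_trans (by positivity) hK)
  refine ⟨2 * Real.exp (c * C) + 2 * Real.exp (c * β) + (4 / c + Real.exp (c / 2)) + 2,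
    by positivity, c / 4, by positivity, fun f hf x hx r hr lam hlam => ⟨fun hr0 => ?_,
      fun hr0 => ?_⟩⟩
  · by_cases hne : {N : ℕ | BallDoubling μ ρ β x (2 ^ N * r)}.Nonempty
    · refine hnear f hf x hx r hr lam hlam _ C _ (hdy f hf x hx r hr hr0 _ (Nat.sInf_mem hne)
        fun k hk hd => Nat.notMem_of_lt_sInf hk hd) ?_
      have : 0 ≤ 2 * Real.exp (c * β) + (4 / c + Real.exp (c / 2)) + 2 := by positivity
      linarith
    · rw [not_nonempty_iff_eq_empty.1 hne, Nat.sInf_empty, pow_zero, one_mul]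
      set A := |ballAvg μ f x r - doublingAvg μ ρ β f x r| with hA
      rcases le_or_gt lam (2 * A) with hl | hl
      · refine (measure_mono (sep_subset _ _)).trans ?_
        rw [← ofReal_ballMass, ← ofReal_ballMass, ← ENNReal.ofReal_mul (by positivity)]
        refine ENNReal.ofReal_le_ofReal
          ((h.mass_le_exp_avg_sub_doublingAvg hc hf hx hr (H f hf x hx r hr)).trans ?_)
        have := ballMass_nonneg (μ := μ) x (ρ * r)
        have h1 : 0 ≤ 2 * Real.exp (c * C) + 2 * Real.exp (c * β) + 2 := by positivity
        refine mul_le_mul_of_nonneg_right (mul_le_mul ?_ ?_ (Real.exp_pos _).le ?_) this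
        · linarith
        · exact Real.exp_le_exp.2 (by nlinarith)
        · positivity
      · refine le_trans (measure_mono ?_) ((H f hf x hx r hr (lam / 2)).trans ?_)
        · intro y hy
          refine ⟨hy.1, ?_⟩
          have h1 := abs_sub_le (f y) (doublingAvg μ ρ β f x r) (ballAvg μ f x r)
          rw [abs_sub_comm (doublingAvg μ ρ β f x r)] at h1
          have h2 := hy.2
          linarith
        · refine mul_le_mul_left (ENNReal.ofReal_le_ofReal (mul_le_mul ?_ ?_
            (Real.exp_pos _).le (by positivity))) _
          · have : 0 ≤ 2 * Real.exp (c * C) + 2 * Real.exp (c * β) +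
                (4 / c + Real.exp (c / 2)) := by
              positivity
            linarith
          · exact Real.exp_le_exp.2 (by nlinarith)
  · have h1 := hnear f hf x hx r hr lam hlam 0 β
      (2 * Real.exp (c * C) + 2 * Real.exp (c * β) + (4 / c + Real.exp (c / 2)) + 2) ?_ ?_
    · simpa using h1
    · rw [sub_zero]
      have hle := h.le_doublingRadius x hr
      exact hf.abs_avg_le hη hx (hr.trans_le hle) (hr0.trans_le hle)
        (h.doubling_doublingRadius hx hr)
    · have : 0 ≤ 2 * Real.exp (c * C) + (4 / c + Real.exp (c / 2)) + 2 := by positivity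
      linarith

end BallGrowth

end BallExponential

section CubeTransfer

variable {d : ℕ}

lemma measurableEmbedding_ofLp : MeasurableEmbedding (WithLp.ofLp : Euc d → Fin d → ℝ) :=
  (MeasurableEquiv.toLp 2 (Fin d → ℝ)).symm.measurableEmbedding

lemma Cube.set_eq_preimage (Q : Cube d) (h : 0 ≤ Q.side) :
    Q.set = WithLp.ofLp ⁻¹' closedBall (WithLp.ofLp Q.center) (Q.side / 2) := by
  ext y
  simp [Cube.set, closedBall_pi _ (div_nonneg h zero_le_two), Real.dist_eq]

/-- A measure on Euclidean space viewed on `ℝ^d` with the sup norm, whose balls are cubes. -/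
def supMeasure (μ : Measure (Euc d)) : Measure (Fin d → ℝ) := μ.map WithLp.ofLp

variable {μ : Measure (Euc d)}

lemma measure_inter_cube_eq (Q : Cube d) (h : 0 ≤ Q.side) (p : (Fin d → ℝ) → Prop) :
    μ {x ∈ Q.set | p (WithLp.ofLp x)} =
      supMeasure μ {y ∈ closedBall (WithLp.ofLp Q.center) (Q.side / 2) | p y} := by
  rw [supMeasure, measurableEmbedding_ofLp.map_apply, Q.set_eq_preimage h]
  rfl

lemma measure_cube_eq (Q : Cube d) (h : 0 ≤ Q.side) :
    μ Q.set = supMeasure μ (closedBall (WithLp.ofLp Q.center) (Q.side / 2)) := by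
  rw [supMeasure, measurableEmbedding_ofLp.map_apply, Q.set_eq_preimage h]

lemma toReal_measure_cube (Q : Cube d) (h : 0 ≤ Q.side) :
    (μ Q.set).toReal = ballMass (supMeasure μ) (WithLp.ofLp Q.center) (Q.side / 2) := by
  rw [measure_cube_eq Q h]
  rfl

lemma setIntegral_cube_eq (Q : Cube d) (h : 0 ≤ Q.side) (f : Euc d → ℝ) :
    ∫ x in Q.set, f x ∂μ =
      ∫ y in closedBall (WithLp.ofLp Q.center) (Q.side / 2), f (WithLp.toLp 2 y)
        ∂(supMeasure μ) := by
  rw [supMeasure, measurableEmbedding_ofLp.setIntegral_map, Q.set_eq_preimage h]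

lemma cubeAvg_eq (Q : Cube d) (h : 0 ≤ Q.side) (f : Euc d → ℝ) :
    cubeAvg μ Q f = ballAvg (supMeasure μ) (fun y => f (WithLp.toLp 2 y))
      (WithLp.ofLp Q.center) (Q.side / 2) := by
  rw [cubeAvg, setIntegral_cube_eq Q h, toReal_measure_cube Q h, ballAvg]

lemma isCube_iff (Q : Cube d) :
    IsCube μ Q ↔ 0 < Q.side ∧ WithLp.ofLp Q.center ∈ (supMeasure μ).support := by
  rw [IsCube, Measure.mem_support_iff_forall]
  refine and_congr_right fun _ => ⟨fun h U hU => ?_, fun h r hr => ?_⟩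
  · rw [supMeasure, measurableEmbedding_ofLp.map_apply]
    obtain ⟨r, hr, hrU⟩ := Metric.mem_nhds_iff.1
      ((PiLp.continuous_ofLp 2 fun _ : Fin d => ℝ).continuousAt.preimage_mem_nhds hU)
    exact (h r hr).trans_le (measure_mono hrU)
  · have h1 := h (WithLp.toLp 2 ⁻¹' ball Q.center r)
      ((PiLp.continuous_toLp 2 fun _ : Fin d => ℝ).continuousAt.preimage_mem_nhds
        (ball_mem_nhds _ hr))
    rwa [supMeasure, measurableEmbedding_ofLp.map_apply, ← preimage_comp,
      show WithLp.toLp 2 ∘ WithLp.ofLp = (id : Euc d → Euc d) from rfl, preimage_id] at h1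

lemma isLocallyFiniteMeasure_supMeasure [IsLocallyFiniteMeasure μ] :
    IsLocallyFiniteMeasure (supMeasure μ) :=
  ⟨fun x => by
    obtain ⟨U, hU, hlt⟩ := μ.finiteAt_nhds (WithLp.toLp 2 x)
    refine ⟨WithLp.toLp 2 ⁻¹' U,
      (PiLp.continuous_toLp 2 fun _ : Fin d => ℝ).continuousAt.preimage_mem_nhds hU, ?_⟩
    rwa [supMeasure, measurableEmbedding_ofLp.map_apply, ← preimage_comp,
      show WithLp.toLp 2 ∘ WithLp.ofLp = (id : Euc d → Euc d) from rfl, preimage_id]⟩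

lemma locallyIntegrable_supMeasure {f : Euc d → ℝ} (hf : LocallyIntegrable f μ) :
    LocallyIntegrable (fun y => f (WithLp.toLp 2 y)) (supMeasure μ) := by
  intro x
  obtain ⟨U, hU, hi⟩ := hf (WithLp.toLp 2 x)
  refine ⟨WithLp.toLp 2 ⁻¹' U,
    (PiLp.continuous_toLp 2 fun _ : Fin d => ℝ).continuousAt.preimage_mem_nhds hU, ?_⟩
  rw [supMeasure, measurableEmbedding_ofLp.integrableOn_map_iff]
  exact hi

lemma isDoubling_dilate_iff [IsLocallyFiniteMeasure (supMeasure μ)] {ρ β : ℝ} (hρ : 0 ≤ ρ)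
    (hβ : 0 ≤ β) (Q : Cube d) (h : 0 ≤ Q.side) {α : ℝ} (hα : 0 ≤ α) :
    IsDoubling μ ρ β (Q.dilate α) ↔
      BallDoubling (supMeasure μ) ρ β (WithLp.ofLp Q.center) (α * (Q.side / 2)) := by
  have h1 : 0 ≤ α * Q.side := mul_nonneg hα h
  rw [IsDoubling, measure_cube_eq _ (mul_nonneg hρ h1), measure_cube_eq _ h1, BallDoubling,
    ← ENNReal.ofReal_le_ofReal_iff (mul_nonneg hβ (ballMass_nonneg _ _)),
    ENNReal.ofReal_mul hβ, ofReal_ballMass, ofReal_ballMass]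
  simp only [Cube.dilate, mul_div_assoc]

lemma dilate_one (Q : Cube d) : Q.dilate 1 = Q := by
  simp [Cube.dilate]

lemma isDoubling_iff [IsLocallyFiniteMeasure (supMeasure μ)] {ρ β : ℝ} (hρ : 0 ≤ ρ)
    (hβ : 0 ≤ β) (Q : Cube d) (h : 0 ≤ Q.side) :
    IsDoubling μ ρ β Q ↔
      BallDoubling (supMeasure μ) ρ β (WithLp.ofLp Q.center) (Q.side / 2) := by
  have := isDoubling_dilate_iff (μ := μ) hρ hβ Q h zero_le_one
  rwa [dilate_one, one_mul] at this

lemma cubeAvg_tilde_eq [IsLocallyFiniteMeasure (supMeasure μ)] {ρ β : ℝ} (hρ : 0 ≤ ρ)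
    (hβ : 0 ≤ β) (Q : Cube d) (h : 0 ≤ Q.side) (f : Euc d → ℝ) :
    cubeAvg μ (tilde μ ρ β Q) f =
      ballAvg (supMeasure μ) (fun y => f (WithLp.toLp 2 y)) (WithLp.ofLp Q.center)
        (2 ^ sInf {N : ℕ | BallDoubling (supMeasure μ) ρ β (WithLp.ofLp Q.center)
          (2 ^ N * (Q.side / 2))} * (Q.side / 2)) := by
  have h1 : {N : ℕ | IsDoubling μ ρ β (Q.dilate (2 ^ N))} =
      {N : ℕ | BallDoubling (supMeasure μ) ρ β (WithLp.ofLp Q.center)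
          (2 ^ N * (Q.side / 2))} :=
    Set.ext fun N => isDoubling_dilate_iff hρ hβ Q h (by positivity)
  rw [tilde, h1, cubeAvg_eq _ (mul_nonneg (by positivity) h)]
  simp only [Cube.dilate, mul_div_assoc]

lemma SQR_le (n : ℕ) (Q R : Cube d) (h : 0 < Q.side) {N : ℕ} (hN : 0 < N)
    (hNR : R.side ≤ 2 ^ N * Q.side) :
    SQR μ n Q R ≤ 1 + ∑ k ∈ Finset.Icc 1 N,
      ballMass (supMeasure μ) (WithLp.ofLp Q.center) (2 ^ k * (Q.side / 2)) /
        (2 ^ k * (Q.side / 2)) ^ n := by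
  have hle : NQR Q R ≤ N := Nat.sInf_le ⟨hN, hNR⟩
  rw [SQR]
  gcongr 1 + ?_
  refine (Finset.sum_le_sum_of_subset_of_nonneg (Finset.Icc_subset_Icc_right hle)
    fun k _ _ => by positivity).trans (Finset.sum_le_sum fun k _ => ?_)
  rw [toReal_measure_cube _ (by simp only [Cube.dilate]; positivity)]
  simp only [Cube.dilate, mul_div_assoc]
  have := ballMass_nonneg (μ := supMeasure μ) (WithLp.ofLp Q.center) (2 ^ k * (Q.side / 2))
  gcongr
  linarith

lemma ballAvg_const_mul {E : Type*} [NormedAddCommGroup E] [MeasurableSpace E]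
    (ν : Measure E) (a : ℝ) (f : E → ℝ) (x : E) (r : ℝ) :
    ballAvg ν (fun y => a * f y) x r = a * ballAvg ν f x r := by
  rw [ballAvg, ballAvg, integral_const_mul]
  ring

lemma ballOsc_of_rbmoLocBound [IsLocallyFiniteMeasure (supMeasure μ)] {n : ℕ} {η ρ β K : ℝ}
    {f : Euc d → ℝ} (hη : 0 ≤ η) (hρ : 0 ≤ ρ) (hβ : 0 ≤ β) (hf : LocallyIntegrable f μ)
    (hK : 0 < K) (h : RbmoLocBound μ n η ρ β f K) :
    BallOsc (supMeasure μ) n η ρ β (1 / 2) fun y => K⁻¹ * f (WithLp.toLp 2 y) := by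
  have hcube : ∀ x ∈ (supMeasure μ).support, ∀ r : ℝ, 0 < r →
      IsCube μ ⟨WithLp.toLp 2 x, 2 * r⟩ := fun x hx r hr =>
    (isCube_iff _).2 ⟨by positivity, hx⟩
  obtain ⟨h1, h2, h3⟩ := h
  have hside : ∀ r : ℝ, 2 * r / 2 = r := fun r => mul_div_cancel_left₀ r two_ne_zero
  have hη' : ∀ r : ℝ, η * (2 * r) / 2 = η * r := fun r => by ring
  refine ⟨(locallyIntegrable_supMeasure hf).smul K⁻¹, ?_, ?_, ?_⟩
  · intro x hx r hr hr1 N hN hlt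
    have hr2 : (0 : ℝ) ≤ 2 * r := by positivity
    have hi : sInf {N : ℕ | BallDoubling (supMeasure μ) ρ β x (2 ^ N * r)} = N :=
      le_antisymm (Nat.sInf_le hN) (le_csInf ⟨N, hN⟩ fun b hb => not_lt.1 fun hb' => hlt b hb' hb)
    have h4 := h1 _ (hcube x hx r hr) (by dsimp only; linarith)
    rw [cubeAvg_tilde_eq hρ hβ _ hr2, setIntegral_cube_eq _ hr2,
      toReal_measure_cube _ (mul_nonneg hη hr2)] at h4
    simp only [Cube.dilate, hside, hη', hi] at h4
    simp only [ballAvg_const_mul, ← mul_sub, abs_mul, integral_const_mul, abs_of_pos (inv_pos.2 hK)]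
    rwa [inv_mul_le_iff₀ hK]
  · intro x hx y hy r s hr hr1 hrs hsub hdx hdy N hN hNs
    have hs : 0 < s := hr.trans_le hrs
    have hr2 : (0 : ℝ) ≤ 2 * r := by positivity
    have hs2 : (0 : ℝ) ≤ 2 * s := by positivity
    have h4 := h2 _ _ (hcube x hx r hr) (hcube y hy s hs) (by dsimp only; linarith) (by
        rw [Cube.set_eq_preimage _ hr2, Cube.set_eq_preimage _ hs2]
        simp only [hside]
        exact preimage_mono hsub)
      ((isDoubling_iff hρ hβ _ hr2).2 (by simpa only [hside] using hdx))
      ((isDoubling_iff hρ hβ _ hs2).2 (by simpa only [hside] using hdy))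
    have h5 := SQR_le (μ := μ) n ⟨WithLp.toLp 2 x, 2 * r⟩ ⟨WithLp.toLp 2 y, 2 * s⟩
      (by positivity) hN (by dsimp only; linarith)
    rw [cubeAvg_eq _ hr2, cubeAvg_eq _ hs2] at h4
    simp only [hside] at h4 h5
    simp only [ballAvg_const_mul, ← mul_sub, abs_mul, abs_of_pos (inv_pos.2 hK)]
    rw [inv_mul_le_iff₀ hK]
    exact h4.trans (mul_le_mul_of_nonneg_left h5 hK.le)
  · intro x hx r hr1
    have hr : 0 < r := lt_trans (by norm_num) hr1
    have hr2 : (0 : ℝ) ≤ 2 * r := by positivity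
    have h4 := h3 _ (hcube x hx r hr) (by dsimp only; linarith)
    rw [setIntegral_cube_eq _ hr2, toReal_measure_cube _ (mul_nonneg hη hr2)] at h4
    simp only [Cube.dilate, hside, hη'] at h4
    simp only [abs_mul, integral_const_mul, abs_of_pos (inv_pos.2 hK)]
    rwa [inv_mul_le_iff₀ hK]

lemma ballGrowth_supMeasure {n : ℕ} {C₀ ρ β : ℝ} (hC₀ : 0 < C₀)
    (hgrowthQ : ∀ Q : Cube d, IsCube μ Q → μ Q.set ≤ ENNReal.ofReal (C₀ * Q.side ^ n))
    (hρ : 1 < ρ) (hβ : ρ ^ n < β) :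
    BallGrowth (supMeasure μ) n ρ β ((Real.logb ρ β - n) / 2) (C₀ * 2 ^ n) := by
  have hρ0 : 0 < ρ := zero_lt_one.trans hρ
  have hβ0 : 0 < β := (pow_pos hρ0 n).trans hβ
  refine ⟨hρ, ?_, ?_, by positivity, fun x hx r hr => ?_⟩
  · have : (n : ℝ) < Real.logb ρ β := by
      rw [Real.lt_logb_iff_rpow_lt hρ hβ0, Real.rpow_natCast]
      exact hβ
    linarith
  · rw [show (n : ℝ) + 2 * ((Real.logb ρ β - n) / 2) = Real.logb ρ β by ring,
      Real.rpow_logb hρ0 hρ.ne' hβ0]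
  · have hr2 : 0 < 2 * r := by positivity
    have h1 := hgrowthQ ⟨WithLp.toLp 2 x, 2 * r⟩ ((isCube_iff _).2 ⟨hr2, hx⟩)
    have h2 := ENNReal.toReal_le_of_le_ofReal (by positivity) h1
    rw [toReal_measure_cube _ hr2.le] at h2
    simp only [mul_div_cancel_left₀ r (two_ne_zero (α := ℝ)), mul_pow] at h2
    linarith

lemma exists_rbmoLocBound {n : ℕ} {η ρ β : ℝ} {f : Euc d → ℝ} (hf : MemRbmoLoc μ n η ρ β f)
    (hpos : 0 < rbmoLocNorm μ n η ρ β f) :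
    ∃ K, 0 < K ∧ K < 2 * rbmoLocNorm μ n η ρ β f ∧ RbmoLocBound μ n η ρ β f K := by
  have hne : {C : ℝ | 0 ≤ C ∧ RbmoLocBound μ n η ρ β f C}.Nonempty := hf.2
  obtain ⟨K, hK, hlt⟩ := exists_lt_of_csInf_lt hne
    (show rbmoLocNorm μ n η ρ β f < 2 * rbmoLocNorm μ n η ρ β f by linarith)
  exact ⟨K, hpos.trans_le (csInf_le ⟨0, fun _ h => h.1⟩ hK), hlt, hK.2⟩

end CubeTransfer

/-- local John–Nirenberg inequality for `rbmo(μ)`. -/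
theorem john_nirenberg_rbmoLoc
    {d n : ℕ} (μ : Measure (Euc d)) (C₀ η ρ β : ℝ)
    (hn : 0 < n) (hnd : n ≤ d) (hC₀ : 0 < C₀)
    (hgrowth : ∀ x : Euc d, ∀ r : ℝ, 0 < r →
      μ (Metric.ball x r) ≤ ENNReal.ofReal (C₀ * r ^ n))
    (hgrowthQ : ∀ Q : Cube d, IsCube μ Q → μ Q.set ≤ ENNReal.ofReal (C₀ * Q.side ^ n))
    (hη : 1 < η) (hηρ : η ≤ ρ) (hρ : 1 < ρ) (hβ : ρ ^ n < β) :
    ∃ C₄ : ℝ, 0 < C₄ ∧ ∃ C₅ : ℝ, 0 < C₅ ∧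
      ∀ f : Euc d → ℝ, MemRbmoLoc μ n η ρ β f → 0 < rbmoLocNorm μ n η ρ β f →
        ∀ lam : ℝ, 0 < lam →
          (∀ Q : Cube d, IsCube μ Q → Q.side ≤ 1 →
            μ {x ∈ Q.set | lam < |f x - cubeAvg μ (tilde μ ρ β Q) f|}
              ≤ ENNReal.ofReal (C₄ * Real.exp (-(C₅ * lam) / rbmoLocNorm μ n η ρ β f))
                * μ (Q.dilate ρ).set) ∧
          (∀ Q : Cube d, IsCube μ Q → 1 < Q.side →
            μ {x ∈ Q.set | lam < |f x|}
              ≤ ENNReal.ofReal (C₄ * Real.exp (-(C₅ * lam) / rbmoLocNorm μ n η ρ β f))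
                * μ (Q.dilate ρ).set) := by
  have hρ0 : 0 ≤ ρ := zero_le_one.trans hρ.le
  have hβ0 : 0 ≤ β := (pow_nonneg hρ0 n).trans hβ.le
  have : IsLocallyFiniteMeasure μ := ⟨fun x => ⟨ball x 1, ball_mem_nhds x one_pos,
    (hgrowth x 1 one_pos).trans_lt ENNReal.ofReal_lt_top⟩⟩
  have : IsLocallyFiniteMeasure (supMeasure μ) := isLocallyFiniteMeasure_supMeasure
  obtain ⟨C, hC, c, hc, H⟩ :=
    (ballGrowth_supMeasure hC₀ hgrowthQ hρ hβ).john_nirenberg hηρ hη.le (1 / 2)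
  refine ⟨C, hC, c / 2, half_pos hc, fun f hf hpos lam hlam => ?_⟩
  obtain ⟨K, hK, hlt, hb⟩ := exists_rbmoLocBound hf hpos
  have hosc := ballOsc_of_rbmoLocBound (zero_le_one.trans hη.le) hρ0 hβ0 hf.1 hK hb
  have hexp : ENNReal.ofReal (C * Real.exp (-(c * (K⁻¹ * lam)))) ≤
      ENNReal.ofReal (C * Real.exp (-(c / 2 * lam) / rbmoLocNorm μ n η ρ β f)) := by
    refine ENNReal.ofReal_le_ofReal
      (mul_le_mul_of_nonneg_left (Real.exp_le_exp.2 ?_) hC.le)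
    rw [neg_div, neg_le_neg_iff, div_le_iff₀ hpos,
      show c * (K⁻¹ * lam) * rbmoLocNorm μ n η ρ β f =
        c / 2 * lam * (2 * rbmoLocNorm μ n η ρ β f / K) by ring]
    exact le_mul_of_one_le_right (by positivity) ((one_le_div hK).2 hlt.le)
  have hKlam : 0 < K⁻¹ * lam := by positivity
  have hscale : ∀ t : ℝ, lam < |t| ↔ K⁻¹ * lam < |K⁻¹ * t| := fun t => by
    rw [abs_mul, abs_of_pos (inv_pos.2 hK), mul_lt_mul_iff_right₀ (inv_pos.2 hK)]
  have hdil : ∀ Q : Cube d, 0 ≤ Q.side → μ (Q.dilate ρ).set =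
      supMeasure μ (closedBall (WithLp.ofLp Q.center) (ρ * (Q.side / 2))) := fun Q hQ => by
    rw [measure_cube_eq _ (mul_nonneg hρ0 hQ)]
    simp only [Cube.dilate, mul_div_assoc]
  refine ⟨fun Q hQ hQ1 => ?_, fun Q hQ hQ1 => ?_⟩ <;>
    obtain ⟨hside, hsupp⟩ := (isCube_iff Q).1 hQ <;>
    rw [hdil Q hside.le] <;>
    refine le_trans ?_ (mul_le_mul_left hexp _)
  · rw [cubeAvg_tilde_eq hρ0 hβ0 Q hside.le]
    have h1 := (H _ hosc _ hsupp _ (half_pos hside) _ hKlam).1 (by linarith)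
    simp only [ballAvg_const_mul, ← mul_sub, ← hscale] at h1
    exact (measure_inter_cube_eq Q hside.le _).trans_le h1
  · have h1 := (H _ hosc _ hsupp _ (half_pos hside) _ hKlam).2 (by linarith)
    simp only [← hscale] at h1
    exact (measure_inter_cube_eq Q hside.le _).trans_le h1
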